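/- arXiv:2004.08899 — 7 statements merged into one kernel-verified Lean document; each statement's English description precedes it below -/
import Mathlib

section
/- Let p and q be prime numbers with p ≡ 5 (mod 8), q ≡ 3 (mod 8), and Legendre symbol (p/q) = 1. Let (x, y) be the fundamental solution in positive integers of the Pell equation x² − 2pq·y² = 1. Then there exist positive integers y₁ and y₂ such that x − 1 = p·y₁² and x + 1 = 2q·y₂² (in particular p(x−1) is a perfect square, y = y₁y₂, and 2 = 2q·y₂² − p·y₁²). -/
theorem exists_eq_mul_sq_of_coprime_mul_eq_mul_sq {a b n m : ℕ} (hn : 0 < n)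
    (hab : a.Coprime b) (h : a * b = n * m ^ 2) :
    ∃ d e u v : ℕ, d * e = n ∧ a = d * u ^ 2 ∧ b = e * v ^ 2 ∧ u * v = m := by
  have hde : n.gcd a * n.gcd b = n := by
    rw [← Nat.Coprime.gcd_mul n hab, h]
    exact Nat.gcd_eq_left (dvd_mul_right _ _)
  obtain ⟨s, hs⟩ := Nat.gcd_dvd_right n a
  obtain ⟨t, ht⟩ := Nat.gcd_dvd_right n b
  have hst : s * t = m ^ 2 := by
    apply Nat.eq_of_mul_eq_mul_left hn
    rw [← h]
    calc n * (s * t) = (n.gcd a * n.gcd b) * (s * t) := by rw [hde]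
      _ = (n.gcd a * s) * (n.gcd b * t) := by ring
      _ = a * b := by rw [← hs, ← ht]
  have hcop : s.Coprime t :=
    Nat.Coprime.coprime_dvd_left (Dvd.intro_left _ hs.symm)
      (Nat.Coprime.coprime_dvd_right (Dvd.intro_left _ ht.symm) hab)
  obtain ⟨u, hu⟩ := exists_eq_pow_of_mul_eq_pow (Nat.isUnit_iff.mpr hcop) hst
  obtain ⟨v, hv⟩ := exists_eq_pow_of_mul_eq_pow (Nat.isUnit_iff.mpr hcop.symm)
    ((mul_comm t s).trans hst)
  refine ⟨_, _, u, v, hde, hu ▸ hs, hv ▸ ht, ?_⟩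
  have : (u * v) ^ 2 = m ^ 2 := by rw [mul_pow, ← hu, ← hv, hst]
  exact Nat.pow_left_injective two_ne_zero this

theorem legendreSym_eq_one_of_dvd_mul_sq_sub_one {p : ℕ} [Fact p.Prime] {c v : ℤ}
    (h : (p : ℤ) ∣ c * v ^ 2 - 1) : legendreSym p c = 1 := by
  have h1 : (c : ZMod p) * (v : ZMod p) ^ 2 = 1 := by
    have := (ZMod.intCast_zmod_eq_zero_iff_dvd _ p).mpr h
    push_cast at this
    exact sub_eq_zero.mp this
  have hc : (c : ZMod p) ≠ 0 := by rintro h0; simp [h0] at h1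
  rw [legendreSym.eq_one_iff p hc]
  exact ⟨c * v, by linear_combination (-(c : ZMod p)) * h1⟩

/-- For `p ≡ 5` and `q ≡ 3` modulo `8` with `(p/q) = 1`, local obstructions leave only two
factorizations `d * e = 2pq` for which `e * v ^ 2 = d * u ^ 2 + 1` can be solvable. -/
theorem eq_of_mul_eq_two_mul_mul_of_mul_sq_eq_mul_sq_add_one
    {p q : ℕ} [Fact p.Prime] [Fact q.Prime]
    (hp : p % 8 = 5) (hq : q % 8 = 3) (hleg : legendreSym q (p : ℤ) = 1)
    {d e u v : ℕ} (hde : d * e = 2 * p * q) (h : e * v ^ 2 = d * u ^ 2 + 1) :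
    d = 2 * p * q ∧ e = 1 ∨ d = 2 * p ∧ e = q := by
  have hp0 := (Fact.out : p.Prime)
  have hq0 := (Fact.out : q.Prime)
  have p1 : legendreSym p (-1) = 1 := by
    rw [legendreSym.at_neg_one (by omega), ZMod.χ₄_nat_one_mod_four (by omega)]
  have p2 : legendreSym p 2 = -1 := by
    rw [legendreSym.at_two (by omega), ZMod.χ₈_nat_mod_eight, hp]; rfl
  have pq : legendreSym p q = 1 := by
    rw [← legendreSym.quadratic_reciprocity_one_mod_four (p := p) (by omega) (by omega), hleg]
  have q1 : legendreSym q (-1) = -1 := by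
    rw [legendreSym.at_neg_one (by omega), ZMod.χ₄_nat_three_mod_four (by omega)]
  have q2 : legendreSym q 2 = -1 := by
    rw [legendreSym.at_two (by omega), ZMod.χ₈_nat_mod_eight, hq]; rfl
  have hz : (e : ℤ) * v ^ 2 = d * u ^ 2 + 1 := by exact_mod_cast h
  have left {r : ℕ} [Fact r.Prime] (hr : (r : ℤ) ∣ d) : legendreSym r e = 1 := by
    apply legendreSym_eq_one_of_dvd_mul_sq_sub_one (v := v)
    rw [hz, add_sub_cancel_right]
    exact hr.mul_right _
  have right {r : ℕ} [Fact r.Prime] (hr : (r : ℤ) ∣ e) : legendreSym r (-1 * d) = 1 := by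
    apply legendreSym_eq_one_of_dvd_mul_sq_sub_one (v := u)
    rw [show -1 * (d : ℤ) * u ^ 2 - 1 = -(e * v ^ 2) by rw [hz]; ring]
    exact (hr.mul_right _).neg_right
  obtain ⟨d', d₃, hd', hd₃, hd⟩ := (Nat.dvd_mul).mp (Dvd.intro _ hde)
  obtain ⟨d₁, d₂, hd₁, hd₂, rfl⟩ := (Nat.dvd_mul).mp hd'
  subst hd
  have hpp := hp0.pos
  have hqp := hq0.pos
  rcases (Nat.dvd_prime Nat.prime_two).mp hd₁ with rfl | rfl <;>
  rcases (Nat.dvd_prime hp0).mp hd₂ with hd₂ | hd₂ <;>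
  rcases (Nat.dvd_prime hq0).mp hd₃ with hd₃ | hd₃ <;> subst d₂ d₃
  · obtain rfl : e = 2 * p * q := by linarith
    have := right (r := q) (by simp)
    simp [q1] at this
  · obtain rfl : e = 2 * p := Nat.eq_of_mul_eq_mul_left hqp (by linarith)
    have := left (r := q) (by simp)
    simp [legendreSym.mul, q2, hleg] at this
  · obtain rfl : e = 2 * q := Nat.eq_of_mul_eq_mul_left hpp (by linarith)
    have := left (r := p) (by simp)
    simp [legendreSym.mul, p2, pq] at this
  · obtain rfl : e = 2 := Nat.eq_of_mul_eq_mul_left (Nat.mul_pos hpp hqp) (by linarith)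
    have := left (r := p) (by simp)
    simp [p2] at this
  · obtain rfl : e = p * q := by linarith
    have := right (r := p) (by simp)
    rw [legendreSym.mul] at this
    simp [p1, p2] at this
  · obtain rfl : e = p := Nat.eq_of_mul_eq_mul_left hqp (by linarith)
    have := right (r := e) (by simp)
    rw [legendreSym.mul] at this
    simp [legendreSym.mul, p1, p2, pq] at this
  · right
    exact ⟨by ring, Nat.eq_of_mul_eq_mul_left hpp (by linarith)⟩
  · left
    exact ⟨rfl, Nat.eq_of_mul_eq_mul_left
      (Nat.mul_pos (Nat.mul_pos two_pos hpp) hqp) (by linarith)⟩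

theorem pell_2pq_case_legendre_one
    (p q : ℕ) [Fact (Nat.Prime p)] [Fact (Nat.Prime q)]
    (hp : p % 8 = 5) (hq : q % 8 = 3) (hleg : legendreSym q (p : ℤ) = 1)
    (x y : ℤ) (hx : 0 < x) (hy : 0 < y)
    (hpell : x ^ 2 - 2 * p * q * y ^ 2 = 1)
    (hmin : ∀ x' y' : ℤ, 0 < x' → 0 < y' →
      x' ^ 2 - 2 * p * q * y' ^ 2 = 1 → x ≤ x') :
    ∃ y₁ y₂ : ℤ, 0 < y₁ ∧ 0 < y₂ ∧
      x - 1 = p * y₁ ^ 2 ∧ x + 1 = 2 * q * y₂ ^ 2 ∧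
      y = y₁ * y₂ ∧ IsSquare ((p : ℤ) * (x - 1)) ∧
      (2 : ℤ) = 2 * q * y₂ ^ 2 - p * y₁ ^ 2 := by
  have hxodd : Odd x := by
    refine (Int.odd_pow' two_ne_zero).mp ⟨p * q * y ^ 2, ?_⟩
    linear_combination hpell
  obtain ⟨a, rfl⟩ := hxodd
  have hyeven : Even y := by
    by_contra hodd
    obtain ⟨k, rfl⟩ := Int.not_even_iff_odd.mp hodd
    have hpq : Odd ((p : ℤ) * q) :=
      Odd.mul (by rw [Int.odd_iff]; omega) (by rw [Int.odd_iff]; omega)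
    have hev : Even ((p : ℤ) * q * (2 * k + 1) ^ 2) :=
      ⟨a ^ 2 + a, by linarith⟩
    exact Int.not_even_iff_odd.mpr (hpq.mul (odd_two_mul_add_one k).pow) hev
  obtain ⟨m, rfl⟩ := hyeven
  lift a to ℕ using by omega
  lift m to ℕ using by omega
  have hprod : a * (a + 1) = (2 * p * q) * m ^ 2 := by
    zify
    linarith
  have hn : 0 < 2 * p * q :=
    Nat.mul_pos (Nat.mul_pos two_pos (Nat.pos_of_ne_zero (NeZero.ne p)))
      (Nat.pos_of_ne_zero (NeZero.ne q))
  obtain ⟨d, e, u, v, hde, ha, hb, rfl⟩ :=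
    exists_eq_mul_sq_of_coprime_mul_eq_mul_sq hn (by simp) hprod
  have huv : 0 < u * v := by omega
  have hu : 0 < u := Nat.pos_of_mul_pos_right huv
  have hv : 0 < v := Nat.pos_of_mul_pos_left huv
  rcases eq_of_mul_eq_two_mul_mul_of_mul_sq_eq_mul_sq_add_one hp hq hleg hde
    (u := u) (v := v) (by rw [← hb, ← ha]) with ⟨rfl, rfl⟩ | ⟨rfl, rfl⟩
  · exfalso
    zify at ha hb hv
    have hle := hmin v u (by exact_mod_cast hv) (by exact_mod_cast hu)
      (by linear_combination ha - hb)
    have hapos : (0 : ℤ) < a := by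
      have : 0 < 2 * p * q * u ^ 2 := Nat.mul_pos hn (pow_pos hu 2)
      rw [ha]; exact_mod_cast this
    nlinarith
  · zify at ha hb
    refine ⟨2 * u, v, by positivity, by positivity, ?_, ?_, ?_, ⟨p * (2 * u), ?_⟩, ?_⟩
    · linear_combination 2 * ha
    · linear_combination 2 * hb
    · push_cast; ring
    · linear_combination 2 * (p : ℤ) * ha
    · linear_combination 2 * hb - 2 * ha
end

section
/- Let p and q be prime numbers with p ≡ 5 (mod 8), q ≡ 3 (mod 8), and Legendre symbol (p/q) = 1. Let (a, b) be the fundamental solution in positive integers of the Pell equation a² − pq·b² = 1. Then there exist positive integers b₁ and b₂ such that a + 1 = 2p·b₁² and a − 1 = 2q·b₂² (in particular 2p(a+1) is a perfect square and 1 = p·b₁² − q·b₂²). -/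
/-- If coprime positive integers multiply to a square, the first factor is a positive square. -/
lemma Int.exists_pos_sq_of_isCoprime_mul_eq_sq {u v c : ℤ} (hu : 0 < u) (huv : IsCoprime u v)
    (h : u * v = c ^ 2) : ∃ r : ℤ, 0 < r ∧ u = r ^ 2 := by
  obtain ⟨r, hr | hr⟩ := Int.sq_of_isCoprime huv h
  · have hr0 : r ≠ 0 := by rintro rfl; simp at hr; omega
    exact ⟨|r|, abs_pos.mpr hr0, by rw [sq_abs, hr]⟩
  · nlinarith [sq_nonneg r]

/-- If coprime positive integers `d * u` and `e * v` satisfy `u * v = c ^ 2`, then `u` and `v` are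
positive squares. -/
lemma Int.exists_pos_sq_pair {d e u v c : ℤ} (hd : 0 < d) (he : 0 < e) (hu : 0 < d * u)
    (hv : 0 < e * v) (huv : IsCoprime (d * u) (e * v)) (h : u * v = c ^ 2) :
    ∃ r s : ℤ, 0 < r ∧ 0 < s ∧ d * u = d * r ^ 2 ∧ e * v = e * s ^ 2 := by
  have hcop : IsCoprime u v := huv.of_mul_left_right.of_mul_right_right
  obtain ⟨r, hr, rfl⟩ :=
    Int.exists_pos_sq_of_isCoprime_mul_eq_sq (pos_of_mul_pos_right hu hd.le) hcop h
  obtain ⟨s, hs, rfl⟩ :=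
    Int.exists_pos_sq_of_isCoprime_mul_eq_sq (pos_of_mul_pos_right hv he.le) hcop.symm
      (by rw [mul_comm, h])
  exact ⟨r, s, hr, hs, rfl, rfl⟩

/-- Coprime positive integers whose product is `p * q` times a square, with `p ≠ q` prime, are
squares up to a factorization of `p * q`. -/
lemma Int.exists_sq_of_isCoprime_mul_eq_prime_mul_prime_mul_sq {p q : ℕ} (hp : p.Prime)
    (hq : q.Prime) (hpq : p ≠ q) {u v c : ℤ} (hu : 0 < u) (hv : 0 < v) (huv : IsCoprime u v)
    (h : u * v = p * q * c ^ 2) :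
    ∃ r s : ℤ, 0 < r ∧ 0 < s ∧
      ((u = r ^ 2 ∧ v = p * q * s ^ 2) ∨ (u = p * q * r ^ 2 ∧ v = s ^ 2) ∨
        (u = p * r ^ 2 ∧ v = q * s ^ 2) ∨ (u = q * r ^ 2 ∧ v = p * s ^ 2)) := by
  have hp0 : (0 : ℤ) < p := by exact_mod_cast hp.pos
  have hq0 : (0 : ℤ) < q := by exact_mod_cast hq.pos
  have hpq0 : (0 : ℤ) < p * q := mul_pos hp0 hq0
  have hcop : IsCoprime (p : ℤ) q :=
    Nat.isCoprime_iff_coprime.mpr ((Nat.coprime_primes hp hq).mpr hpq)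
  have hpd : (p : ℤ) ∣ u * v := ⟨q * c ^ 2, by rw [h]; ring⟩
  have hqd : (q : ℤ) ∣ u * v := ⟨p * c ^ 2, by rw [h]; ring⟩
  rcases (Nat.prime_iff_prime_int.mp hp).dvd_or_dvd hpd with hpu | hpv <;>
    rcases (Nat.prime_iff_prime_int.mp hq).dvd_or_dvd hqd with hqu | hqv
  · obtain ⟨w, rfl⟩ := hcop.mul_dvd hpu hqu
    obtain ⟨r, s, hr, hs, h1, h2⟩ := Int.exists_pos_sq_pair (c := c) hpq0 one_pos hu
      (by simpa using hv) (by simpa using huv)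
      (mul_left_cancel₀ hpq0.ne' (by linear_combination h))
    exact ⟨r, s, hr, hs, .inr (.inl ⟨h1, by simpa using h2⟩)⟩
  · obtain ⟨u, rfl⟩ := hpu
    obtain ⟨v, rfl⟩ := hqv
    obtain ⟨r, s, hr, hs, h1, h2⟩ := Int.exists_pos_sq_pair (c := c) hp0 hq0 hu hv huv
      (mul_left_cancel₀ hpq0.ne' (by linear_combination h))
    exact ⟨r, s, hr, hs, .inr (.inr (.inl ⟨h1, h2⟩))⟩
  · obtain ⟨u, rfl⟩ := hqu
    obtain ⟨v, rfl⟩ := hpv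
    obtain ⟨r, s, hr, hs, h1, h2⟩ := Int.exists_pos_sq_pair (c := c) hq0 hp0 hu hv huv
      (mul_left_cancel₀ hpq0.ne' (by linear_combination h))
    exact ⟨r, s, hr, hs, .inr (.inr (.inr ⟨h1, h2⟩))⟩
  · obtain ⟨w, rfl⟩ := hcop.mul_dvd hpv hqv
    obtain ⟨r, s, hr, hs, h1, h2⟩ := Int.exists_pos_sq_pair (c := c) one_pos hpq0
      (by simpa using hu) hv (by simpa using huv)
      (mul_left_cancel₀ hpq0.ne' (by linear_combination h))
    exact ⟨r, s, hr, hs, .inl ⟨by simpa using h1, h2⟩⟩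

/-- `3` is not a sum of two squares modulo `4`. -/
lemma Int.sq_add_sq_emod_four_ne_three (r s : ℤ) : (r ^ 2 + s ^ 2) % 4 ≠ 3 := by
  rcases Int.even_or_odd' r with ⟨m, rfl | rfl⟩ <;> rcases Int.even_or_odd' s with ⟨n, rfl | rfl⟩ <;>
    ring_nf <;> omega

theorem pell_pq_case_legendre_one
    (p q : ℕ) [Fact (Nat.Prime p)] [Fact (Nat.Prime q)]
    (hp : p % 8 = 5) (hq : q % 8 = 3) (hleg : legendreSym q (p : ℤ) = 1)
    (a b : ℤ) (ha : 0 < a) (hb : 0 < b)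
    (hpell : a ^ 2 - p * q * b ^ 2 = 1)
    (hmin : ∀ a' b' : ℤ, 0 < a' → 0 < b' →
      a' ^ 2 - p * q * b' ^ 2 = 1 → a ≤ a') :
    ∃ b₁ b₂ : ℤ, 0 < b₁ ∧ 0 < b₂ ∧
      a + 1 = 2 * p * b₁ ^ 2 ∧ a - 1 = 2 * q * b₂ ^ 2 ∧
      IsSquare (2 * (p : ℤ) * (a + 1)) ∧
      (1 : ℤ) = p * b₁ ^ 2 - q * b₂ ^ 2 := by
  have hpp : p.Prime := Fact.out
  have hqp : q.Prime := Fact.out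
  have hpq : p ≠ q := by rintro rfl; omega
  have hpq0 : (0 : ℤ) < p * q := by exact_mod_cast mul_pos hpp.pos hqp.pos
  have ha1 : 1 < a := by
    by_contra hcon
    have : a = 1 := by omega
    subst this
    have := mul_pos hpq0 (pow_pos hb 2)
    linarith
  rcases Int.even_or_odd' a with ⟨k, hk | hk⟩
  · exfalso
    have h2 : ¬ IsSquare (2 : ZMod p) := by
      rw [ZMod.exists_sq_eq_two_iff (by omega)]; omega
    obtain ⟨w, hw⟩ : IsSquare (-1 : ZMod p) := ZMod.exists_sq_eq_neg_one_iff.mpr (by omega)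
    obtain ⟨t, ht⟩ : IsSquare (q : ZMod p) := by
      rw [legendreSym.quadratic_reciprocity_one_mod_four (by omega) (by omega)] at hleg
      have hne : ((q : ℤ) : ZMod p) ≠ 0 := by
        intro h0
        rw [(legendreSym.eq_zero_iff p _).mpr h0] at hleg
        exact zero_ne_one hleg
      simpa using (legendreSym.eq_one_iff p hne).mp hleg
    obtain ⟨r, s, -, -, h⟩ := Int.exists_sq_of_isCoprime_mul_eq_prime_mul_prime_mul_sq hpp hqp hpq
      (u := a + 1) (v := a - 1) (c := b) (by omega) (by omega)
      ⟨1 - k, k, by rw [hk]; ring⟩ (by linear_combination hpell)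
    have hcast : ((a : ZMod p) + 1) - (a - 1) = 2 := by ring
    rcases h with ⟨h1, h3⟩ | ⟨h1, h3⟩ | ⟨h1, h3⟩ | ⟨h1, h3⟩ <;>
      apply_fun ((↑) : ℤ → ZMod p) at h1 h3 <;> push_cast at h1 h3 <;>
      rw [h1, h3] at hcast <;> simp only [CharP.cast_eq_zero, zero_mul, sub_zero, zero_sub] at hcast
    · exact h2 ⟨r, by rw [← hcast]; ring⟩
    · exact h2 ⟨w * s, by linear_combination -hcast + s ^ 2 * hw⟩
    · exact h2 ⟨w * t * s, by linear_combination -hcast - s ^ 2 * ht + s ^ 2 * t ^ 2 * hw⟩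
    · exact h2 ⟨t * r, by linear_combination -hcast + r ^ 2 * ht⟩
  · obtain ⟨c, rfl⟩ : (2 : ℤ) ∣ b := by
      have hev : Even (p * q * b ^ 2 : ℤ) := ⟨2 * k ^ 2 + 2 * k, by rw [hk] at hpell; linarith⟩
      have hpo : ¬ Even (p : ℤ) := by rw [Int.even_iff]; omega
      have hqo : ¬ Even (q : ℤ) := by rw [Int.even_iff]; omega
      simp only [Int.even_mul, hpo, hqo, false_or, Int.even_pow] at hev
      exact hev.1.two_dvd
    have hk0 : 0 < k := by omega
    obtain ⟨r, s, hr, hs, h⟩ := Int.exists_sq_of_isCoprime_mul_eq_prime_mul_prime_mul_sq hpp hqp hpq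
      (u := k + 1) (v := k) (c := c) (by omega) hk0 ⟨1, -1, by ring⟩
      (by rw [hk] at hpell; linarith)
    obtain ⟨m, hm⟩ : ∃ m : ℤ, (p : ℤ) = 4 * m + 1 := ⟨p / 4, by omega⟩
    obtain ⟨n, hn⟩ : ∃ n : ℤ, (q : ℤ) = 4 * n + 3 := ⟨q / 4, by omega⟩
    rcases h with ⟨h1, h3⟩ | ⟨h1, h3⟩ | ⟨h1, h3⟩ | ⟨h1, h3⟩
    · have := hmin r s hr hs (by rw [← h1, ← h3]; ring)
      nlinarith
    · refine absurd ?_ (Int.sq_add_sq_emod_four_ne_three r s)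
      have : r ^ 2 + s ^ 2 = 4 * ((4 * m * n + 3 * m + n + 1) * r ^ 2 - 1) + 3 := by
        rw [hm, hn] at h1
        linear_combination h1 - h3
      omega
    · refine ⟨r, s, hr, hs, by linear_combination hk + 2 * h1, by linear_combination hk + 2 * h3,
        ⟨2 * p * r, by linear_combination 2 * p * (hk + 2 * h1)⟩, by linear_combination h1 - h3⟩
    · refine absurd ?_ (Int.sq_add_sq_emod_four_ne_three r s)
      have : r ^ 2 + s ^ 2 = 4 * ((n + 1) * r ^ 2 - m * s ^ 2 - 1) + 3 := by
        rw [hn] at h1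
        rw [hm] at h3
        linear_combination h1 - h3
      omega
end

section
/- Let q be a prime number with q ≡ 3 (mod 8). Let (c, d) be the fundamental solution in positive integers of the Pell equation c² − 2q·d² = 1. Then there exist positive integers d₁ and d₂ such that c − 1 = d₁² and c + 1 = 2q·d₂² (in particular c − 1 is a perfect square and 2 = −d₁² + 2q·d₂²). -/
theorem exists_pos_sq_of_isCoprime_of_mul_eq_sq {x y e : ℤ} (hx : 0 < x) (hy : 0 < y)
    (h : IsCoprime x y) (he : x * y = e ^ 2) :
    ∃ a b : ℤ, 0 < a ∧ 0 < b ∧ x = a ^ 2 ∧ y = b ^ 2 := by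
  have key : ∀ {u v : ℤ}, 0 < u → IsCoprime u v → u * v = e ^ 2 → ∃ a : ℤ, 0 < a ∧ u = a ^ 2 := by
    intro u v hu huv heq
    obtain ⟨a, ha | ha⟩ := Int.sq_of_isCoprime huv heq
    · refine ⟨|a|, abs_pos.2 ?_, by rw [sq_abs, ha]⟩
      rintro rfl
      simp [ha] at hu
    · nlinarith [sq_nonneg a]
  obtain ⟨a, ha, hxa⟩ := key hx h he
  obtain ⟨b, hb, hyb⟩ := key hy h.symm (by rw [mul_comm, he])
  exact ⟨a, b, ha, hb, hxa, hyb⟩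

theorem Int.sq_emod_eight (a : ℤ) : a ^ 2 % 8 = 0 ∨ a ^ 2 % 8 = 1 ∨ a ^ 2 % 8 = 4 := by
  have : a % 8 = 0 ∨ a % 8 = 1 ∨ a % 8 = 2 ∨ a % 8 = 3 ∨ a % 8 = 4 ∨ a % 8 = 5 ∨ a % 8 = 6 ∨
      a % 8 = 7 := by lia
  rcases this with h | h | h | h | h | h | h | h <;> simp [pow_two, Int.mul_emod, h]

theorem pell_2q_case
    (q : ℕ) [Fact (Nat.Prime q)] (hq : q % 8 = 3)
    (c d : ℤ) (hc : 0 < c) (hd : 0 < d)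
    (hpell : c ^ 2 - 2 * q * d ^ 2 = 1)
    (hmin : ∀ c' d' : ℤ, 0 < c' → 0 < d' →
      c' ^ 2 - 2 * q * d' ^ 2 = 1 → c ≤ c') :
    ∃ d₁ d₂ : ℤ, 0 < d₁ ∧ 0 < d₂ ∧
      c - 1 = d₁ ^ 2 ∧ c + 1 = 2 * q * d₂ ^ 2 ∧
      IsSquare (c - 1) ∧
      (2 : ℤ) = -d₁ ^ 2 + 2 * q * d₂ ^ 2 := by
  have hqp : Prime (q : ℤ) := Nat.prime_iff_prime_int.1 Fact.out
  have hq0 : (0 : ℤ) < q := by lia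
  obtain ⟨t, ht⟩ : ∃ t : ℤ, (q : ℤ) = 8 * t + 3 := ⟨q / 8, by lia⟩
  obtain ⟨m, rfl⟩ : ∃ m, c = 2 * m + 1 := by
    rcases Int.even_or_odd c with ⟨k, rfl⟩ | h
    · have : 2 * (2 * k ^ 2 - q * d ^ 2) = 1 := by linear_combination hpell
      lia
    · exact h
  obtain ⟨e, rfl⟩ : ∃ e, d = 2 * e := by
    rcases Int.even_or_odd d with ⟨k, rfl⟩ | ⟨k, rfl⟩
    · exact ⟨k, by ring⟩
    · have : 4 * (m ^ 2 + m - q * (2 * k ^ 2 + 2 * k) - 4 * t) = 6 := by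
        linear_combination hpell + 2 * ht
      lia
  have hprod : m * (m + 1) = 2 * q * e ^ 2 :=
    mul_left_cancel₀ (four_ne_zero' ℤ) (by linear_combination hpell)
  have hm : 0 < m := by
    have he : 0 < e := by lia
    have : 0 < q * e ^ 2 := by positivity
    nlinarith
  have hqdvd : (q : ℤ) ∣ m ∨ (q : ℤ) ∣ m + 1 := hqp.dvd_or_dvd ⟨2 * e ^ 2, by rw [hprod]; ring⟩
  have hq2 : IsCoprime (q : ℤ) 2 := ⟨1, -(4 * t + 1), by rw [ht]; ring⟩
  have hq0' : (q : ℤ) ≠ 0 := hq0.ne'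
  rcases hqdvd with hqm | hqm <;> rcases Int.even_or_odd m with hpar | hpar
  · obtain ⟨k, hk⟩ := hq2.mul_dvd hqm hpar.two_dvd
    have hk0 : 0 < k := by by_contra! h; nlinarith
    obtain ⟨a, b, ha, hb, hka, hmb⟩ := exists_pos_sq_of_isCoprime_of_mul_eq_sq (e := e) hk0
      (by lia : 0 < m + 1) ⟨-(q * 2), 1, by linear_combination hk⟩
      (mul_left_cancel₀ (mul_ne_zero hq0' two_ne_zero)
        (by linear_combination hprod - (m + 1) * hk))
    have := hmin b a hb ha (by linear_combination -hmb + hk + 2 * q * hka)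
    nlinarith
  · obtain ⟨k, hk⟩ := hqm
    obtain ⟨l, hl⟩ := (hpar.add_one).two_dvd
    obtain ⟨a, b, -, -, hka, hlb⟩ := exists_pos_sq_of_isCoprime_of_mul_eq_sq (e := e)
      (by by_contra! h; nlinarith : 0 < k) (by lia : 0 < l)
      ⟨-q, 2, by linear_combination hk - hl⟩
      (mul_left_cancel₀ (mul_ne_zero two_ne_zero hq0')
        (by linear_combination hprod - (m + 1) * hk - q * k * hl))
    have : 8 * (t * k) + 3 * k + 1 = 2 * l := by
      linear_combination hl - hk - k * ht
    have h1 := Int.sq_emod_eight a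
    have h2 := Int.sq_emod_eight b
    rw [← hka] at h1
    rw [← hlb] at h2
    lia
  · obtain ⟨k, hk⟩ := hqm
    obtain ⟨l, hl⟩ := hpar.two_dvd
    obtain ⟨a, b, ha, hb, hla, hkb⟩ := exists_pos_sq_of_isCoprime_of_mul_eq_sq (e := e)
      (by lia : 0 < l) (by by_contra! h; nlinarith : 0 < k)
      ⟨-2, q, by linear_combination hl - hk⟩
      (mul_left_cancel₀ (mul_ne_zero two_ne_zero hq0')
        (by linear_combination hprod - m * hk - q * k * hl))
    refine ⟨2 * a, b, by lia, hb, ?_, ?_, ⟨2 * a, ?_⟩, ?_⟩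
    · linear_combination 2 * hl + 4 * hla
    · linear_combination 2 * hk + 2 * q * hkb
    · linear_combination 2 * hl + 4 * hla
    · linear_combination 2 * hk + 2 * q * hkb - 2 * hl - 4 * hla
  · obtain ⟨k, hk⟩ := hq2.mul_dvd hqm hpar.add_one.two_dvd
    obtain ⟨a, b, -, -, hma, hkb⟩ := exists_pos_sq_of_isCoprime_of_mul_eq_sq (e := e) hm
      (by by_contra! h; nlinarith : 0 < k) ⟨-1, q * 2, by linear_combination -hk⟩
      (mul_left_cancel₀ (mul_ne_zero hq0' two_ne_zero)
        (by linear_combination hprod - m * hk))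
    have : m + 1 = 16 * (t * k) + 6 * k := by linear_combination hk + 2 * k * ht
    have h1 := Int.sq_emod_eight a
    have h2 := Int.sq_emod_eight b
    rw [← hma] at h1
    rw [← hkb] at h2
    lia
end

section
/- Let q be a prime number with q ≡ 3 (mod 8). Let (α, β) be the fundamental solution in positive integers of the Pell equation α² − q·β² = 1. Then there exist positive integers β₁ and β₂ such that α − 1 = β₁² and α + 1 = q·β₂² (in particular α − 1 is a perfect square and 2 = −β₁² + q·β₂²). -/
/-- A square which is a product of two positive coprime integers has square factors. -/
theorem exists_pos_sq_of_isCoprime_of_mul_eq_sq_s3 {u v n : ℤ} (hu : 0 < u) (hv : 0 < v)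
    (h : IsCoprime u v) (huv : u * v = n ^ 2) :
    ∃ a b : ℤ, 0 < a ∧ 0 < b ∧ u = a ^ 2 ∧ v = b ^ 2 := by
  have key : ∀ {s t : ℤ}, 0 < s → IsCoprime s t → s * t = n ^ 2 → ∃ a : ℤ, 0 < a ∧ s = a ^ 2 := by
    intro s t hs hst hn
    obtain ⟨a, ha | ha⟩ := Int.sq_of_isCoprime hst hn
    · exact ⟨|a|, abs_pos.2 (by rintro rfl; simp [ha] at hs), by rw [ha, sq_abs]⟩
    · nlinarith [sq_nonneg a]
  obtain ⟨a, ha, hua⟩ := key hu h huv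
  obtain ⟨b, hb, hvb⟩ := key hv h.symm (by rw [mul_comm, huv])
  exact ⟨a, b, ha, hb, hua, hvb⟩

/-- If a product of two positive coprime integers is a prime times a square, then one factor is a
square and the other is the prime times a square. -/
theorem exists_pos_sq_of_isCoprime_of_mul_eq_prime_mul_sq {p u v n : ℤ} (hp : Prime p)
    (hp0 : 0 < p) (hu : 0 < u) (hv : 0 < v) (h : IsCoprime u v) (huv : u * v = p * n ^ 2) :
    ∃ a b : ℤ, 0 < a ∧ 0 < b ∧
      ((u = p * a ^ 2 ∧ v = b ^ 2) ∨ (u = a ^ 2 ∧ v = p * b ^ 2)) := by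
  rcases hp.dvd_or_dvd (Dvd.intro _ huv.symm) with ⟨w, rfl⟩ | ⟨w, rfl⟩
  · obtain ⟨a, b, ha, hb, rfl, rfl⟩ := exists_pos_sq_of_isCoprime_of_mul_eq_sq_s3
      (pos_of_mul_pos_right hu hp0.le) hv h.of_mul_left_right
      (mul_left_cancel₀ hp.ne_zero (by rw [← huv]; ring))
    exact ⟨a, b, ha, hb, .inl ⟨rfl, rfl⟩⟩
  · obtain ⟨a, b, ha, hb, rfl, rfl⟩ := exists_pos_sq_of_isCoprime_of_mul_eq_sq_s3
      hu (pos_of_mul_pos_right hv hp0.le) h.of_mul_right_right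
      (mul_left_cancel₀ hp.ne_zero (by rw [← huv]; ring))
    exact ⟨a, b, ha, hb, .inr ⟨rfl, rfl⟩⟩

theorem sq_add_one_ne_mul_sq_of_emod_four_eq_three {q : ℤ} (hq : q % 4 = 3) (a b : ℤ) :
    a ^ 2 + 1 ≠ q * b ^ 2 := by
  intro h
  obtain ⟨k, rfl⟩ : ∃ k, q = 4 * k + 3 := ⟨q / 4, by omega⟩
  rcases Int.even_or_odd' a with ⟨c, rfl | rfl⟩ <;>
    rcases Int.even_or_odd' b with ⟨d, rfl | rfl⟩ <;>
    ring_nf at h <;> omega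

theorem sq_sub_mul_sq_ne_two_of_emod_eight_eq_three {q : ℤ} (hq : q % 8 = 3) (a b : ℤ) :
    b ^ 2 - q * a ^ 2 ≠ 2 := by
  intro h
  obtain ⟨k, rfl⟩ : ∃ k, q = 8 * k + 3 := ⟨q / 8, by omega⟩
  rcases Int.even_or_odd' a with ⟨c, rfl | rfl⟩ <;>
    rcases Int.even_or_odd' b with ⟨d, rfl | rfl⟩
  iterate 3
    · ring_nf at h
      omega
  · obtain ⟨r, hr⟩ := Int.even_mul_succ_self c
    obtain ⟨s, hs⟩ := Int.even_mul_succ_self d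
    have : 8 * (s - (8 * k + 3) * r - k) = 4 := by
      linear_combination h - 4 * hs + 4 * (8 * k + 3) * hr
    omega

theorem pell_q_case
    (q : ℕ) [Fact (Nat.Prime q)] (hq : q % 8 = 3)
    (α β : ℤ) (hα : 0 < α) (hβ : 0 < β)
    (hpell : α ^ 2 - q * β ^ 2 = 1)
    (hmin : ∀ α' β' : ℤ, 0 < α' → 0 < β' →
      α' ^ 2 - q * β' ^ 2 = 1 → α ≤ α') :
    ∃ β₁ β₂ : ℤ, 0 < β₁ ∧ 0 < β₂ ∧
      α - 1 = β₁ ^ 2 ∧ α + 1 = q * β₂ ^ 2 ∧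
      IsSquare (α - 1) ∧
      (2 : ℤ) = -β₁ ^ 2 + q * β₂ ^ 2 := by
  have hqp : Prime (q : ℤ) := Nat.prime_iff_prime_int.1 Fact.out
  have hq0 : (0 : ℤ) < q := by omega
  have hq8 : (q : ℤ) % 8 = 3 := by omega
  have hα1 : 1 < α := by nlinarith [mul_pos hq0 (pow_pos hβ 2)]
  rcases Int.even_or_odd' α with ⟨m, rfl | rfl⟩
  · have hcop : IsCoprime (2 * m - 1) (2 * m + 1) := ⟨-(m + 1), m, by ring⟩
    obtain ⟨a, b, ha, hb, ⟨h₁, h₂⟩ | ⟨h₁, h₂⟩⟩ :=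
      exists_pos_sq_of_isCoprime_of_mul_eq_prime_mul_sq (n := β) hqp hq0
        (by omega) (by omega) hcop (by linear_combination hpell)
    · exact absurd (by linarith) (sq_sub_mul_sq_ne_two_of_emod_eight_eq_three hq8 a b)
    · exact ⟨a, b, ha, hb, h₁, h₂, ⟨a, by rw [h₁, sq]⟩, by linarith⟩
  · have hβ2 : Even β := by
      by_contra hodd
      obtain ⟨k, rfl⟩ := Int.not_even_iff_odd.1 hodd
      have : (q : ℤ) = 2 * (2 * m ^ 2 + 2 * m - q * (2 * k ^ 2 + 2 * k)) := by
        linear_combination -hpell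
      omega
    obtain ⟨n, rfl⟩ := even_iff_two_dvd.1 hβ2
    have hcop : IsCoprime m (m + 1) := ⟨-1, 1, by ring⟩
    obtain ⟨a, b, ha, hb, ⟨h₁, h₂⟩ | ⟨h₁, h₂⟩⟩ :=
      exists_pos_sq_of_isCoprime_of_mul_eq_prime_mul_sq (n := n) hqp hq0
        (by omega) (by omega) hcop (by linarith)
    · have hle := hmin b a hb ha (by linarith)
      nlinarith
    · exact absurd (by linarith) (sq_add_one_ne_mul_sq_of_emod_four_eq_three (q := q) (by omega) a b)
end

section
/- Let p and q be prime numbers with p ≡ 5 (mod 8), q ≡ 3 (mod 8), and Legendre symbol (p/q) = −1. Let (x, y) be the fundamental solution in positive integers of the Pell equation x² − 2pq·y² = 1. Then there exist positive integers y₁ and y₂ such that x − 1 = 2p·y₁² and x + 1 = q·y₂² (in particular 2p(x−1) is a perfect square and 2 = −2p·y₁² + q·y₂²). -/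
/-- A prime dividing a product of two integers can be cancelled from one of the factors. -/
theorem Prime.exists_eq_mul_of_mul_eq_mul {l a b c : ℤ} (hl : Prime l) (h : a * b = l * c) :
    (∃ a', a = l * a' ∧ a' * b = c) ∨ ∃ b', b = l * b' ∧ a * b' = c := by
  rcases hl.dvd_or_dvd (Dvd.intro c h.symm) with ⟨a', rfl⟩ | ⟨b', rfl⟩
  · exact .inl ⟨a', rfl, mul_left_cancel₀ hl.ne_zero (by rw [← h]; ring)⟩
  · exact .inr ⟨b', rfl, mul_left_cancel₀ hl.ne_zero (by rw [← h]; ring)⟩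

/-- The positive cofactors of coprime integers are squares when their product is a square. -/
theorem IsCoprime.exists_eq_sq_of_mul_eq_sq {d e a b c : ℤ} (hco : IsCoprime (d * a) (e * b))
    (hd : 0 < d) (he : 0 < e) (ha : 0 < d * a) (hb : 0 < e * b) (h : a * b = c ^ 2) :
    ∃ r s : ℤ, 0 < r ∧ 0 < s ∧ a = r ^ 2 ∧ b = s ^ 2 := by
  have key : ∀ {a b : ℤ}, IsCoprime a b → 0 < a → a * b = c ^ 2 → ∃ r : ℤ, 0 < r ∧ a = r ^ 2 := by
    intro a b hab ha h
    rcases Int.sq_of_gcd_eq_one (Int.isCoprime_iff_gcd_eq_one.mp hab) h with ⟨r, hr | hr⟩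
    · refine ⟨|r|, abs_pos.mpr ?_, by rw [sq_abs, hr]⟩
      rintro rfl
      simp_all
    · nlinarith [sq_nonneg r]
  have hab : IsCoprime a b := hco.of_mul_left_right.of_mul_right_right
  obtain ⟨r, hr, har⟩ := key hab (pos_of_mul_pos_right ha hd.le) h
  obtain ⟨s, hs, hbs⟩ := key hab.symm (pos_of_mul_pos_right hb he.le) (by rw [mul_comm, h])
  exact ⟨r, s, hr, hs, har, hbs⟩

/-- An integer `a` for which `a * s ^ 2 ≡ 1` modulo a prime `l` is a quadratic residue. -/
theorem legendreSym.eq_one_of_mul_sq_eq {l : ℕ} [Fact l.Prime] {a s t : ℤ}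
    (h : a * s ^ 2 = 1 + l * t) : legendreSym l a = 1 := by
  have h' : (a : ZMod l) * (s : ZMod l) ^ 2 = 1 := by
    have := congrArg (Int.cast : ℤ → ZMod l) h
    push_cast at this
    simpa using this
  have ha : (a : ZMod l) ≠ 0 := by
    intro h0
    simp [h0] at h'
  rw [legendreSym.eq_one_iff l ha]
  exact ⟨a * s, by linear_combination -(a : ZMod l) * h'⟩

theorem pell_2pq_case_legendre_neg_one
    (p q : ℕ) [Fact (Nat.Prime p)] [Fact (Nat.Prime q)]
    (hp : p % 8 = 5) (hq : q % 8 = 3) (hleg : legendreSym q (p : ℤ) = -1)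
    (x y : ℤ) (hx : 0 < x) (hy : 0 < y)
    (hpell : x ^ 2 - 2 * p * q * y ^ 2 = 1)
    (hmin : ∀ x' y' : ℤ, 0 < x' → 0 < y' →
      x' ^ 2 - 2 * p * q * y' ^ 2 = 1 → x ≤ x') :
    ∃ y₁ y₂ : ℤ, 0 < y₁ ∧ 0 < y₂ ∧
      x - 1 = 2 * p * y₁ ^ 2 ∧ x + 1 = q * y₂ ^ 2 ∧
      IsSquare (2 * (p : ℤ) * (x - 1)) ∧
      (2 : ℤ) = -(2 * p * y₁ ^ 2) + q * y₂ ^ 2 := by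
  have hp2 : p ≠ 2 := by rintro rfl; omega
  have hq2 : q ≠ 2 := by rintro rfl; omega
  have hp0 : (0 : ℤ) < p := by exact_mod_cast (Fact.out : p.Prime).pos
  have hq0 : (0 : ℤ) < q := by exact_mod_cast (Fact.out : q.Prime).pos
  have hpZ : Prime (p : ℤ) := Nat.prime_iff_prime_int.mp Fact.out
  have hqZ : Prime (q : ℤ) := Nat.prime_iff_prime_int.mp Fact.out
  have hp_neg_one : legendreSym p (-1) = 1 := by
    rw [legendreSym.at_neg_one hp2, ZMod.χ₄_nat_one_mod_four (by omega)]
  have hq_neg_one : legendreSym q (-1) = -1 := by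
    rw [legendreSym.at_neg_one hq2, ZMod.χ₄_nat_three_mod_four (by omega)]
  have hp_two : legendreSym p 2 = -1 := by
    rw [legendreSym.at_two hp2, ZMod.χ₈_nat_mod_eight, hp]
    decide
  have hpq : legendreSym p (q : ℤ) = -1 := by
    rw [← hleg]
    exact (legendreSym.quadratic_reciprocity_one_mod_four (by omega) hq2).symm
  obtain ⟨a, rfl⟩ : ∃ a, x = 2 * a + 1 := by
    rcases Int.even_or_odd' x with ⟨a, rfl | rfl⟩
    · exfalso
      have : 2 * (2 * a ^ 2 - p * q * y ^ 2) = 1 := by linear_combination hpell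
      omega
    · exact ⟨a, rfl⟩
  have hpqy : (p : ℤ) * (q * y ^ 2) = 2 * (a * (a + 1)) := by linarith
  obtain ⟨b, rfl⟩ : ∃ b, y = 2 * b := by
    have hdvd : (2 : ℤ) ∣ p * (q * y ^ 2) := ⟨_, hpqy⟩
    rcases Int.prime_two.dvd_or_dvd hdvd with h | h
    · omega
    rcases Int.prime_two.dvd_or_dvd h with h | h
    · omega
    exact Int.prime_two.dvd_of_dvd_pow h
  have hb : 0 < b := by omega
  have hfac : a * (a + 1) = 2 * (p * (q * b ^ 2)) := by linarith
  have ha : 0 < a := by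
    have : 0 < a * (a + 1) := by rw [hfac]; positivity
    rcases (show a = 0 ∨ 0 < a by omega) with rfl | h
    · simp at this
    · exact h
  have hco : IsCoprime a (a + 1) := ⟨-1, 1, by ring⟩
  have ha1 : 0 < a + 1 := by omega
  have split : ∀ {d e A B : ℤ}, 0 < d → 0 < e → a = d * A → a + 1 = e * B → A * B = b ^ 2 →
      ∃ r s : ℤ, 0 < r ∧ 0 < s ∧ a = d * r ^ 2 ∧ a + 1 = e * s ^ 2 := by
    intro d e A B hd he hA hB hAB
    obtain ⟨r, s, hr, hs, rfl, rfl⟩ := IsCoprime.exists_eq_sq_of_mul_eq_sq (hA ▸ hB ▸ hco) hd he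
      (hA ▸ ha) (hB ▸ ha1) hAB
    exact ⟨r, s, hr, hs, hA, hB⟩
  rcases Int.prime_two.exists_eq_mul_of_mul_eq_mul hfac with ⟨A, hA, h₂⟩ | ⟨B, hB, h₂⟩ <;>
  rcases hpZ.exists_eq_mul_of_mul_eq_mul h₂ with ⟨A', hA', h₃⟩ | ⟨B', hB', h₃⟩ <;>
  rcases hqZ.exists_eq_mul_of_mul_eq_mul h₃ with ⟨A'', hA'', h₄⟩ | ⟨B'', hB'', h₄⟩
  · obtain ⟨r, s, hr, hs, har, has⟩ := split (d := 2 * p * q) (e := 1) (by positivity) one_pos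
      (by rw [hA, hA', hA'']; ring) (one_mul _).symm h₄
    have := hmin s r hs hr (by linarith)
    nlinarith
  · obtain ⟨r, s, hr, hs, har, has⟩ := split (d := 2 * p) (e := q) (by positivity) hq0
      (by rw [hA, hA']; ring) hB'' h₄
    have := legendreSym.eq_one_of_mul_sq_eq (l := p) (a := q) (s := s) (t := 2 * r ^ 2)
      (by linarith)
    omega
  · obtain ⟨r, s, hr, hs, har, has⟩ := split (d := 2 * q) (e := p) (by positivity) hp0
      (by rw [hA, hA'']; ring) hB' h₄
    have := legendreSym.eq_one_of_mul_sq_eq (l := q) (a := p) (s := s) (t := 2 * r ^ 2)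
      (by linarith)
    omega
  · obtain ⟨r, s, hr, hs, har, has⟩ := split (d := 2) (e := p * q) two_pos (by positivity)
      hA (by rw [hB', hB'']; ring) h₄
    have := legendreSym.eq_one_of_mul_sq_eq (l := p) (a := -1 * 2) (s := r) (t := -q * s ^ 2)
      (by linarith)
    rw [legendreSym.mul] at this
    simp_all
  · obtain ⟨r, s, hr, hs, har, has⟩ := split (d := p * q) (e := 2) (by positivity) two_pos
      (by rw [hA', hA'']; ring) hB h₄
    have := legendreSym.eq_one_of_mul_sq_eq (l := p) (a := 2) (s := s) (t := q * r ^ 2)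
      (by linarith)
    omega
  · obtain ⟨r, s, hr, hs, har, has⟩ := split (d := p) (e := 2 * q) hp0 (by positivity)
      hA' (by rw [hB, hB'']; ring) h₄
    exact ⟨r, 2 * s, hr, by positivity, by linarith, by linarith,
      ⟨2 * p * r, by rw [har]; ring⟩, by linarith⟩
  · obtain ⟨r, s, hr, hs, har, has⟩ := split (d := q) (e := 2 * p) hq0 (by positivity)
      hA'' (by rw [hB, hB']; ring) h₄
    have := legendreSym.eq_one_of_mul_sq_eq (l := p) (a := -1 * q) (s := r) (t := -2 * s ^ 2)
      (by linarith)
    rw [legendreSym.mul] at this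
    simp_all
  · obtain ⟨r, s, hr, hs, har, has⟩ := split (d := 1) (e := 2 * p * q) one_pos (by positivity)
      (one_mul _).symm (by rw [hB, hB', hB'']; ring) h₄
    have := legendreSym.eq_one_of_mul_sq_eq (l := q) (a := -1) (s := r) (t := -2 * p * s ^ 2)
      (by linarith)
    omega
end

section
/- Let p and q be prime numbers with p ≡ 5 (mod 8), q ≡ 3 (mod 8), and Legendre symbol (p/q) = −1. Let (a, b) be the fundamental solution in positive integers of the Pell equation a² − pq·b² = 1. Then there exist positive integers b₁ and b₂ such that a + 1 = p·b₁² and a − 1 = q·b₂² (in particular p(a+1) is a perfect square and 2 = p·b₁² − q·b₂²). -/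
theorem Int.exists_pos_sq_of_isCoprime {x y c : ℤ} (hx : 0 < x) (hy : 0 < y)
    (h : IsCoprime x y) (hxy : x * y = c ^ 2) :
    ∃ u v : ℤ, 0 < u ∧ 0 < v ∧ x = u ^ 2 ∧ y = v ^ 2 := by
  have key : ∀ {x y : ℤ}, 0 < x → IsCoprime x y → x * y = c ^ 2 → ∃ u, 0 < u ∧ x = u ^ 2 := by
    intro x y hx h hxy
    obtain ⟨u, hu | hu⟩ := Int.sq_of_isCoprime h hxy
    · refine ⟨|u|, abs_pos.2 ?_, by rw [sq_abs, hu]⟩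
      rintro rfl
      simp [hu] at hx
    · nlinarith [sq_nonneg u]
  obtain ⟨u, hu, hxu⟩ := key hx h hxy
  obtain ⟨v, hv, hyv⟩ := key hy h.symm (by rw [mul_comm, hxy])
  exact ⟨u, v, hu, hv, hxu, hyv⟩

/-- Two coprime positive integers whose product is `p * q` times a square, with `p` and `q`
distinct primes, are squares up to distributing the factors `p` and `q`. -/
theorem Int.exists_sq_of_mul_eq_prime_mul_prime_mul_sq {p q x y c : ℤ} (hp : Prime p)
    (hq : Prime q) (hp0 : 0 < p) (hq0 : 0 < q) (hpq : IsCoprime p q) (hx : 0 < x) (hy : 0 < y)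
    (h : IsCoprime x y) (hxy : x * y = p * q * c ^ 2) :
    ∃ u v : ℤ, 0 < u ∧ 0 < v ∧
      ((x = u ^ 2 ∧ y = p * q * v ^ 2) ∨ (x = p * q * u ^ 2 ∧ y = v ^ 2) ∨
        (x = p * u ^ 2 ∧ y = q * v ^ 2) ∨ (x = q * u ^ 2 ∧ y = p * v ^ 2)) := by
  have hpd : p ∣ x ∨ p ∣ y := hp.dvd_or_dvd ⟨q * c ^ 2, by rw [hxy]; ring⟩
  have hqd : q ∣ x ∨ q ∣ y := hq.dvd_or_dvd ⟨p * c ^ 2, by rw [hxy]; ring⟩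
  have hpq0 : 0 < p * q := mul_pos hp0 hq0
  have cancel : ∀ {m : ℤ}, p * q * m = p * q * c ^ 2 → m = c ^ 2 :=
    fun h => mul_left_cancel₀ hpq0.ne' h
  rcases hpd with hpx | hpy <;> rcases hqd with hqx | hqy
  · obtain ⟨z, rfl⟩ := hpq.mul_dvd hpx hqx
    obtain ⟨u, v, hu, hv, rfl, rfl⟩ := exists_pos_sq_of_isCoprime
      (pos_of_mul_pos_right hx hpq0.le) hy h.of_mul_left_right (cancel (by rw [← hxy]; ring))
    exact ⟨u, v, hu, hv, by simp⟩
  · obtain ⟨z, rfl⟩ := hpx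
    obtain ⟨w, rfl⟩ := hqy
    obtain ⟨u, v, hu, hv, rfl, rfl⟩ := exists_pos_sq_of_isCoprime
      (pos_of_mul_pos_right hx hp0.le) (pos_of_mul_pos_right hy hq0.le)
      h.of_mul_left_right.of_mul_right_right (cancel (by rw [← hxy]; ring))
    exact ⟨u, v, hu, hv, by simp⟩
  · obtain ⟨z, rfl⟩ := hqx
    obtain ⟨w, rfl⟩ := hpy
    obtain ⟨u, v, hu, hv, rfl, rfl⟩ := exists_pos_sq_of_isCoprime
      (pos_of_mul_pos_right hx hq0.le) (pos_of_mul_pos_right hy hp0.le)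
      h.of_mul_left_right.of_mul_right_right (cancel (by rw [← hxy]; ring))
    exact ⟨u, v, hu, hv, by simp⟩
  · obtain ⟨z, rfl⟩ := hpq.mul_dvd hpy hqy
    obtain ⟨u, v, hu, hv, rfl, rfl⟩ := exists_pos_sq_of_isCoprime
      hx (pos_of_mul_pos_right hy hpq0.le) h.of_mul_right_right (cancel (by rw [← hxy]; ring))
    exact ⟨u, v, hu, hv, by simp⟩

theorem ZMod.isSquare_intCast_of_dvd {n : ℕ} {k s : ℤ} (h : (n : ℤ) ∣ k - s ^ 2) :
    IsSquare (k : ZMod n) := by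
  refine ⟨(s : ZMod n), ?_⟩
  rw [← sub_eq_zero, ← sq]
  exact_mod_cast (ZMod.intCast_zmod_eq_zero_iff_dvd _ n).2 h

theorem pell_pq_case_legendre_neg_one
    (p q : ℕ) [Fact (Nat.Prime p)] [Fact (Nat.Prime q)]
    (hp : p % 8 = 5) (hq : q % 8 = 3) (hleg : legendreSym q (p : ℤ) = -1)
    (a b : ℤ) (ha : 0 < a) (hb : 0 < b)
    (hpell : a ^ 2 - p * q * b ^ 2 = 1)
    (hmin : ∀ a' b' : ℤ, 0 < a' → 0 < b' →
      a' ^ 2 - p * q * b' ^ 2 = 1 → a ≤ a') :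
    ∃ b₁ b₂ : ℤ, 0 < b₁ ∧ 0 < b₂ ∧
      a + 1 = p * b₁ ^ 2 ∧ a - 1 = q * b₂ ^ 2 ∧
      IsSquare ((p : ℤ) * (a + 1)) ∧
      (2 : ℤ) = p * b₁ ^ 2 - q * b₂ ^ 2 := by
  have hpp : p.Prime := Fact.out
  have hqp : q.Prime := Fact.out
  have hp0 : (0 : ℤ) < p := by exact_mod_cast hpp.pos
  have hq0 : (0 : ℤ) < q := by exact_mod_cast hqp.pos
  have hcop : IsCoprime (p : ℤ) q := by
    rw [Nat.isCoprime_iff_coprime, Nat.coprime_primes hpp hqp]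
    rintro rfl
    omega
  have hpnq : ¬ IsSquare ((p : ℤ) : ZMod q) := (legendreSym.eq_neg_one_iff q).1 hleg
  have hqnp : ¬ IsSquare ((q : ℤ) : ZMod p) := by
    have := ZMod.exists_sq_eq_prime_iff_of_mod_four_eq_one (p := p) (q := q)
      (by omega) (by omega)
    simpa [this] using hpnq
  have h2q : ¬ IsSquare ((2 : ℤ) : ZMod q) := by
    have := ZMod.exists_sq_eq_two_iff (p := q) (by omega)
    simp [this, hq]
  have hm2p : ¬ IsSquare ((-2 : ℤ) : ZMod p) := by
    have := ZMod.exists_sq_eq_neg_two_iff (p := p) (by omega)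
    simp [this, hp]
  have hm1q : ¬ IsSquare ((-1 : ℤ) : ZMod q) := by
    have := ZMod.exists_sq_eq_neg_one_iff (p := q)
    simp [this]
    omega
  have ha1 : 1 < a := by nlinarith [mul_pos (mul_pos hp0 hq0) (pow_pos hb 2)]
  have split := fun {x y c : ℤ} => Int.exists_sq_of_mul_eq_prime_mul_prime_mul_sq
    (x := x) (y := y) (c := c) (Nat.prime_iff_prime_int.1 hpp) (Nat.prime_iff_prime_int.1 hqp)
    hp0 hq0 hcop
  rcases Int.even_or_odd' a with ⟨m, rfl | rfl⟩
  · obtain ⟨u, v, hu, hv, ⟨h1, h2⟩ | ⟨h1, h2⟩ | ⟨h1, h2⟩ | ⟨h1, h2⟩⟩ :=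
      split (x := 2 * m + 1) (y := 2 * m - 1) (c := b) (by omega) (by omega)
        ⟨1 - m, m, by ring⟩ (by linear_combination hpell)
    · exact absurd (ZMod.isSquare_intCast_of_dvd (s := u)
        ⟨-(p * v ^ 2), by linear_combination h1 - h2⟩) h2q
    · exact absurd (ZMod.isSquare_intCast_of_dvd (s := v)
        ⟨-(q * u ^ 2), by linear_combination h2 - h1⟩) hm2p
    · exact ⟨u, v, hu, hv, h1, h2, ⟨p * u, by rw [h1]; ring⟩, by linear_combination h1 - h2⟩
    · have odd_sq : ∀ {k s : ℤ}, Odd (k * s ^ 2) → s ^ 2 % 8 = 1 := fun h => by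
        have := Int.eight_dvd_sq_sub_one_of_odd ((Int.odd_pow' two_ne_zero).1 (Int.odd_mul.1 h).2)
        omega
      have hu2 := odd_sq (h1 ▸ ⟨m, rfl⟩ : Odd ((q : ℤ) * u ^ 2))
      have hv2 := odd_sq (h2 ▸ ⟨m - 1, by ring⟩ : Odd ((p : ℤ) * v ^ 2))
      have hq8 : (q : ℤ) % 8 = 3 := by omega
      have hp8 : (p : ℤ) % 8 = 5 := by omega
      have e1 : (q : ℤ) * u ^ 2 % 8 = 3 := by rw [Int.mul_emod, hq8, hu2]; rfl
      have e2 : (p : ℤ) * v ^ 2 % 8 = 5 := by rw [Int.mul_emod, hp8, hv2]; rfl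
      omega
  · have hbe : Even b := by
      have : Even ((p : ℤ) * q * b ^ 2) := ⟨2 * m * (m + 1), by linear_combination -hpell⟩
      rcases Int.even_mul.1 this with h | h
      · rw [Int.even_iff, Int.mul_emod, show (p : ℤ) % 2 = 1 by omega,
          show (q : ℤ) % 2 = 1 by omega] at h
        norm_num at h
      · exact (Int.even_pow.1 h).1
    obtain ⟨c, rfl⟩ := hbe
    have hm : 0 < m := by omega
    obtain ⟨u, v, hu, hv, ⟨h1, h2⟩ | ⟨h1, h2⟩ | ⟨h1, h2⟩ | ⟨h1, h2⟩⟩ :=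
      split (x := m + 1) (y := m) (c := c) (by omega) hm ⟨1, -1, by ring⟩
        (by linarith)
    · have := hmin u v hu hv (by linear_combination h2 - h1)
      nlinarith
    · exact absurd (ZMod.isSquare_intCast_of_dvd (s := v)
        ⟨-(p * u ^ 2), by linear_combination h2 - h1⟩) hm1q
    · exact absurd (ZMod.isSquare_intCast_of_dvd (s := p * u)
        ⟨-(p * v ^ 2), by linear_combination p * (h1 - h2)⟩) hpnq
    · exact absurd (ZMod.isSquare_intCast_of_dvd (s := q * u)
        ⟨-(q * v ^ 2), by linear_combination q * (h1 - h2)⟩) hqnp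
end

section
/- Let p and q be prime numbers with p ≡ 5 (mod 8), q ≡ 3 (mod 8), and Legendre symbol (p/q) = 1. Let K = ℚ(√p, √q), and let ε_p, ε_q, ε_{pq} denote the images in the ring of integers of K of the fundamental units (greater than 1 under a real embedding with √p, √q > 0) of ℚ(√p), ℚ(√q), ℚ(√(pq)) respectively. Then ε_{pq} is a square in the ring of integers of K, and for any unit u with u² = ε_{pq}, the unit group of the ring of integers of K is generated by −1, ε_p, ε_q and u; that is, {ε_p, ε_q, √ε_{pq}} is a fundamental system of units of K. -/
/-- The real quadratic field `ℚ(√d)` as a subfield of `ℝ`. -/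
noncomputable def QF (d : ℕ) : IntermediateField ℚ ℝ :=
  IntermediateField.adjoin ℚ {Real.sqrt d}

/-- The real value (under the inclusion in `ℝ`, where all square roots are
positive) of a unit of the ring of integers of a subfield `K` of `ℝ`. -/
noncomputable def uval {K : IntermediateField ℚ ℝ}
    (u : (integralClosure ℤ K)ˣ) : ℝ :=
  (((u : integralClosure ℤ K) : K) : ℝ)

/-- `t` is (the real value of) the fundamental unit of `ℚ(√d)`: a unit of the
ring of integers which is `> 1` and which generates the full unit group
together with `-1`. -/
def IsFundUnit (d : ℕ) (t : ℝ) : Prop :=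
  ∃ ε : (integralClosure ℤ (QF d))ˣ,
    uval ε = t ∧ 1 < t ∧
    ∀ u : (integralClosure ℤ (QF d))ˣ, ∃ n : ℤ, u = ε ^ n ∨ u = -(ε ^ n)

/-- The real multiquadratic field `ℚ(√a, √b)` as a subfield of `ℝ`. -/
noncomputable def K2 (a b : ℕ) : IntermediateField ℚ ℝ :=
  IntermediateField.adjoin ℚ {Real.sqrt a, Real.sqrt b}

theorem exists_sq_sq_of_mul_eq_sq {m k n : ℕ} (h : Nat.Coprime m k) (e : m * k = n ^ 2) :
    ∃ a b, m = a ^ 2 ∧ k = b ^ 2 := by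
  obtain ⟨a, ha⟩ := exists_eq_pow_of_mul_eq_pow (Nat.isUnit_iff.2 h) e
  obtain ⟨b, hb⟩ := exists_eq_pow_of_mul_eq_pow (Nat.isUnit_iff.2 h.symm) ((mul_comm k m).trans e)
  exact ⟨a, b, ha, hb⟩

theorem exists_prime_mul_sq_of_dvd {P m k n : ℕ} (hP : P.Prime) (h : Nat.Coprime m k)
    (e : m * k = P * n ^ 2) (hd : P ∣ m) : ∃ a b, m = P * a ^ 2 ∧ k = b ^ 2 := by
  obtain ⟨m', rfl⟩ := hd
  obtain ⟨a, b, rfl, rfl⟩ := exists_sq_sq_of_mul_eq_sq h.coprime_mul_left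
    (Nat.eq_of_mul_eq_mul_left hP.pos (by rw [← mul_assoc, e]))
  exact ⟨a, b, rfl, rfl⟩

/-- If `m` and `k` are coprime and `m * k = P * n ^ 2` with `P` prime, then one of them is a square
and the other one is `P` times a square. -/
theorem exists_prime_mul_sq {P m k n : ℕ} (hP : P.Prime) (h : Nat.Coprime m k)
    (e : m * k = P * n ^ 2) :
    (∃ a b, m = P * a ^ 2 ∧ k = b ^ 2) ∨ ∃ a b, m = a ^ 2 ∧ k = P * b ^ 2 := by
  rcases hP.dvd_mul.1 (e ▸ dvd_mul_right P _) with hd | hd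
  · exact .inl (exists_prime_mul_sq_of_dvd hP h e hd)
  · obtain ⟨a, b, ha, hb⟩ :=
      exists_prime_mul_sq_of_dvd hP h.symm ((mul_comm k m).trans e) hd
    exact .inr ⟨b, a, hb, ha⟩

/-- If `m` and `k` are coprime and `m * k = P * Q * n ^ 2` with `P`, `Q` prime, then `m` and `k` are
squares up to complementary factors of `P * Q`. -/
theorem exists_prime_mul_prime_mul_sq {P Q m k n : ℕ} (hP : P.Prime) (hQ : Q.Prime)
    (h : Nat.Coprime m k) (e : m * k = P * Q * n ^ 2) :
    ((∃ a b, m = P * Q * a ^ 2 ∧ k = b ^ 2) ∨ ∃ a b, m = a ^ 2 ∧ k = P * Q * b ^ 2) ∨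
    ((∃ a b, m = P * a ^ 2 ∧ k = Q * b ^ 2) ∨ ∃ a b, m = Q * a ^ 2 ∧ k = P * b ^ 2) := by
  rcases hP.dvd_mul.1 (e ▸ (dvd_mul_right P Q).mul_right _) with ⟨m', rfl⟩ | ⟨k', rfl⟩
  · rcases exists_prime_mul_sq (n := n) hQ h.coprime_mul_left
      (Nat.eq_of_mul_eq_mul_left hP.pos (by rw [← mul_assoc, e, mul_assoc])) with
      ⟨a, b, rfl, rfl⟩ | ⟨a, b, rfl, rfl⟩
    · exact .inl (.inl ⟨a, b, by ring, rfl⟩)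
    · exact .inr (.inl ⟨a, b, rfl, rfl⟩)
  · rcases exists_prime_mul_sq (n := n) hQ h.coprime_mul_left_right
      (Nat.eq_of_mul_eq_mul_left hP.pos (by rw [mul_left_comm, e, mul_assoc])) with
      ⟨a, b, rfl, rfl⟩ | ⟨a, b, rfl, rfl⟩
    · exact .inr (.inr ⟨a, b, rfl, rfl⟩)
    · exact .inl (.inr ⟨a, b, rfl, by ring⟩)

/-- The minimal nontrivial solution of the Pell equation `x ^ 2 = d * y ^ 2 + 1`. -/
theorem exists_minimal_pell {d : ℕ} (hd : ¬ IsSquare d) :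
    ∃ x y : ℕ, 1 < x ∧ x ^ 2 = d * y ^ 2 + 1 ∧
      ∀ a b : ℕ, 1 < a → a ^ 2 = d * b ^ 2 + 1 → x ≤ a := by
  classical
  have h0 : 0 < d := Nat.pos_of_ne_zero fun h => hd (h ▸ IsSquare.zero)
  have hex : ∃ x : ℕ, 1 < x ∧ ∃ y : ℕ, x ^ 2 = d * y ^ 2 + 1 := by
    obtain ⟨x, y, h, hy⟩ := Pell.exists_of_not_isSquare (d := (d : ℤ)) (by exact_mod_cast h0)
      (by rwa [Int.isSquare_natCast_iff])
    have key : x.natAbs ^ 2 = d * y.natAbs ^ 2 + 1 := by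
      zify
      rw [sq_abs, sq_abs]
      linarith
    refine ⟨x.natAbs, ?_, y.natAbs, key⟩
    have : 0 < d * y.natAbs ^ 2 := by positivity
    by_contra hx
    have : x.natAbs ^ 2 ≤ 1 := Nat.pow_le_one_iff (by norm_num) |>.2 (by omega)
    omega
  obtain ⟨h1, y, hy⟩ := Nat.find_spec hex
  exact ⟨Nat.find hex, y, h1, hy, fun a b ha hb => Nat.find_min' hex ⟨ha, b, hb⟩⟩

/-- The minimal solution `x` of `x ^ 2 = d * y ^ 2 + 1` cannot satisfy `(x + 1) / 2 = a ^ 2` and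
`(x - 1) / 2 = d * b ^ 2`. -/
theorem pell_descent {d x m a b : ℕ} (hx : 1 < x)
    (hmin : ∀ a b : ℕ, 1 < a → a ^ 2 = d * b ^ 2 + 1 → x ≤ a) (hm : x = 2 * m + 1)
    (ha : m + 1 = a ^ 2) (hb : m = d * b ^ 2) : False := by
  have h1 : 1 < a := by
    by_contra h
    have : a ^ 2 ≤ 1 := Nat.pow_le_one_iff (by norm_num) |>.2 (by omega)
    omega
  have := hmin a b h1 (by omega)
  nlinarith

/-- An odd solution of `x ^ 2 = d * y ^ 2 + 1` with `d` odd yields a product of two consecutive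
numbers. -/
theorem exists_mul_succ_of_pell_odd {d x y m : ℕ} (hd : d % 2 = 1)
    (hxy : x ^ 2 = d * y ^ 2 + 1) (hm : x = 2 * m + 1) :
    ∃ n, m * (m + 1) = d * n ^ 2 := by
  have h4 : 4 * (m * (m + 1)) = d * y ^ 2 := by subst hm; nlinarith
  obtain ⟨n, rfl⟩ : 2 ∣ y := by
    have h2 : 2 ∣ d * y ^ 2 := by omega
    rcases Nat.prime_two.dvd_mul.1 h2 with h | h
    · omega
    · exact Nat.prime_two.dvd_of_dvd_pow h
  exact ⟨n, by nlinarith⟩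

theorem sq_mod_eight (a : ℕ) : a ^ 2 % 8 = 0 ∨ a ^ 2 % 8 = 1 ∨ a ^ 2 % 8 = 4 := by
  have : a % 8 < 8 := Nat.mod_lt _ (by norm_num)
  rw [Nat.pow_mod]
  interval_cases a % 8 <;> simp

theorem exists_sq_add_one_eq_prime_mul_sq {p : ℕ} (hp : p.Prime) (h : p % 4 = 1) :
    ∃ a b : ℕ, a ^ 2 + 1 = p * b ^ 2 := by
  obtain ⟨x, y, hx, hxy, hmin⟩ := exists_minimal_pell hp.prime.not_isSquare
  have hodd : x % 2 = 1 := by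
    have h1 := sq_mod_eight y
    by_contra h2
    obtain ⟨c, rfl⟩ : 2 ∣ x := by omega
    obtain ⟨k, rfl⟩ : ∃ k, p = 4 * k + 1 := ⟨p / 4, by omega⟩
    rw [mul_pow, add_mul, mul_assoc] at hxy
    omega
  obtain ⟨m, hm⟩ : ∃ m, x = 2 * m + 1 := ⟨x / 2, by omega⟩
  obtain ⟨n, hn⟩ := exists_mul_succ_of_pell_odd (by omega) hxy hm
  rcases exists_prime_mul_sq hp (by simp) hn with ⟨a, b, ha, hb⟩ | ⟨a, b, ha, hb⟩
  · exact (pell_descent hx hmin hm hb ha).elim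
  · exact ⟨a, b, by omega⟩

theorem exists_sq_add_two_eq_prime_mul_sq {q : ℕ} (hq : q.Prime) (h : q % 8 = 3) :
    ∃ a b : ℕ, a ^ 2 + 2 = q * b ^ 2 := by
  obtain ⟨x, y, hx, hxy, hmin⟩ := exists_minimal_pell hq.prime.not_isSquare
  obtain ⟨k, hk⟩ : ∃ k, q = 8 * k + 3 := ⟨q / 8, by omega⟩
  rcases Nat.mod_two_eq_zero_or_one x with h2 | h2
  · have hc : Nat.Coprime (x - 1) (x + 1) := by
      have h3 : x + 1 = x - 1 + 2 := by omega
      rw [h3, Nat.coprime_self_add_right]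
      exact (Nat.coprime_two_right).2 (Nat.odd_iff.2 (by omega))
    have e : (x - 1) * (x + 1) = q * y ^ 2 := by
      obtain ⟨z, rfl⟩ : ∃ z, x = z + 1 := ⟨x - 1, by omega⟩
      rw [Nat.add_sub_cancel]
      nlinarith
    rcases exists_prime_mul_sq hq hc e with ⟨a, b, ha, hb⟩ | ⟨a, b, ha, hb⟩
    · exfalso
      have := sq_mod_eight a
      have := sq_mod_eight b
      rw [hk, add_mul, mul_assoc] at ha
      omega
    · exact ⟨a, b, by omega⟩
  · obtain ⟨m, hm⟩ : ∃ m, x = 2 * m + 1 := ⟨x / 2, by omega⟩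
    obtain ⟨n, hn⟩ := exists_mul_succ_of_pell_odd (by omega) hxy hm
    rcases exists_prime_mul_sq hq (by simp) hn with ⟨a, b, ha, hb⟩ | ⟨a, b, ha, hb⟩
    · exact (pell_descent hx hmin hm hb ha).elim
    · exfalso
      have := sq_mod_eight a
      have := sq_mod_eight b
      rw [hk, add_mul, mul_assoc] at hb
      omega

theorem not_isSquare_prime_mul_prime {p q : ℕ} (hp : p.Prime) (hq : q.Prime) (hpq : p ≠ q) :
    ¬ IsSquare (p * q) := by
  rintro ⟨c, hc⟩
  have h1 : p ∣ c := by
    have : p ∣ c * c := hc ▸ dvd_mul_right p q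
    exact (hp.dvd_mul.1 this).elim id id
  obtain ⟨c, rfl⟩ := h1
  have h2 : q = p * (c * c) :=
    Nat.eq_of_mul_eq_mul_left hp.pos (by rw [hc]; ring)
  exact hpq ((Nat.prime_dvd_prime_iff_eq hp hq).1 (h2 ▸ dvd_mul_right p _))

theorem exists_prime_mul_sq_sub_prime_mul_sq {p q : ℕ} [Fact p.Prime] [Fact q.Prime]
    (h5 : p % 8 = 5) (h3 : q % 8 = 3) (hleg : legendreSym q (p : ℤ) = 1) :
    ∃ a b : ℕ, p * a ^ 2 = q * b ^ 2 + 1 ∨ q * b ^ 2 = p * a ^ 2 + 1 := by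
  have hp : p.Prime := Fact.out
  have hq : q.Prime := Fact.out
  have hns : ¬ IsSquare (2 : ZMod q) := by
    rw [ZMod.exists_sq_eq_two_iff (by omega)]
    omega
  have hp0 : ((p : ℤ) : ZMod q) ≠ 0 := by
    intro h0
    rw [(legendreSym.eq_zero_iff q p).2 h0] at hleg
    norm_num at hleg
  have hps : IsSquare (p : ZMod q) := by
    simpa using (legendreSym.eq_one_iff q hp0).1 hleg
  obtain ⟨x, y, hx, hxy, hmin⟩ :=
    exists_minimal_pell (not_isSquare_prime_mul_prime hp hq (by omega))
  obtain ⟨k, hk⟩ : ∃ k, p = 8 * k + 5 := ⟨p / 8, by omega⟩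
  obtain ⟨l, hl⟩ : ∃ l, q = 8 * l + 3 := ⟨q / 8, by omega⟩
  obtain ⟨j, hj⟩ : ∃ j, p * q = 8 * j + 7 := ⟨8 * k * l + 3 * k + 5 * l + 1, by subst hk hl; ring⟩
  rcases Nat.mod_two_eq_zero_or_one x with h2 | h2
  · exfalso
    have hc : Nat.Coprime (x - 1) (x + 1) := by
      have h3 : x + 1 = x - 1 + 2 := by omega
      rw [h3, Nat.coprime_self_add_right]
      exact (Nat.coprime_two_right).2 (Nat.odd_iff.2 (by omega))
    have e : (x - 1) * (x + 1) = p * q * y ^ 2 := by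
      obtain ⟨z, rfl⟩ : ∃ z, x = z + 1 := ⟨x - 1, by omega⟩
      rw [Nat.add_sub_cancel]
      nlinarith
    rcases exists_prime_mul_prime_mul_sq hp hq hc e with
      (⟨a, b, ha, hb⟩ | ⟨a, b, ha, hb⟩) | (⟨a, b, ha, hb⟩ | ⟨a, b, ha, hb⟩)
    · have h4 : b ^ 2 = p * q * a ^ 2 + 2 := by omega
      have h5 : ((b ^ 2 : ℕ) : ZMod q) = ((p * q * a ^ 2 + 2 : ℕ) : ZMod q) := by rw [h4]
      push_cast at h5
      rw [ZMod.natCast_self] at h5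
      exact hns ⟨b, by linear_combination -h5⟩
    · have := sq_mod_eight a
      have := sq_mod_eight b
      rw [hj, add_mul, mul_assoc] at hb
      omega
    · have := sq_mod_eight a
      have := sq_mod_eight b
      rw [hk, add_mul, mul_assoc] at ha
      rw [hl, add_mul, mul_assoc] at hb
      omega
    · have h4 : p * b ^ 2 = q * a ^ 2 + 2 := by omega
      have h5 : ((p * b ^ 2 : ℕ) : ZMod q) = ((q * a ^ 2 + 2 : ℕ) : ZMod q) := by rw [h4]
      push_cast at h5
      rw [ZMod.natCast_self] at h5
      obtain ⟨c, hc⟩ := hps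
      exact hns ⟨c * b, by linear_combination -h5 + b ^ 2 * hc⟩
  · obtain ⟨m, hm⟩ : ∃ m, x = 2 * m + 1 := ⟨x / 2, by omega⟩
    obtain ⟨n, hn⟩ := exists_mul_succ_of_pell_odd (by omega) hxy hm
    rcases exists_prime_mul_prime_mul_sq hp hq (by simp) hn with
      (⟨a, b, ha, hb⟩ | ⟨a, b, ha, hb⟩) | (⟨a, b, ha, hb⟩ | ⟨a, b, ha, hb⟩)
    · exact (pell_descent hx hmin hm hb ha).elim
    · exfalso
      have := sq_mod_eight a
      have := sq_mod_eight b
      rw [hj, add_mul, mul_assoc] at hb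
      omega
    · exact ⟨a, b, .inr (by omega)⟩
    · exact ⟨b, a, .inl (by omega)⟩

theorem sqrt_mem_QF (d : ℕ) : √(d : ℝ) ∈ QF d :=
  IntermediateField.mem_adjoin_simple_self ℚ _

theorem isIntegral_sqrt_natCast (R : Type*) [CommRing R] [Algebra R ℝ] (d : ℕ) :
    IsIntegral R √(d : ℝ) :=
  IsIntegral.of_pow (n := 2) (by norm_num)
    (by rw [Real.sq_sqrt (Nat.cast_nonneg d)]; exact isIntegral_natCast d)

theorem mem_QF_iff {d : ℕ} {x : ℝ} : x ∈ QF d ↔ ∃ r s : ℚ, x = r + s * √(d : ℝ) := by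
  constructor
  · intro hx
    have hd : √(d : ℝ) * √(d : ℝ) = d := Real.mul_self_sqrt (Nat.cast_nonneg d)
    rw [QF, ← IntermediateField.mem_toSubalgebra,
      IntermediateField.adjoin_toSubalgebra_of_isAlgebraic
        (by rintro _ rfl; exact (isIntegral_sqrt_natCast ℚ d).isAlgebraic)] at hx
    induction hx using Algebra.adjoin_induction with
    | mem x h => exact ⟨0, 1, by rw [h]; simp⟩
    | algebraMap r => exact ⟨r, 0, by simp⟩
    | add x y _ _ hx hy =>
      obtain ⟨r, s, rfl⟩ := hx
      obtain ⟨r', s', rfl⟩ := hy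
      exact ⟨r + r', s + s', by push_cast; ring⟩
    | mul x y _ _ hx hy =>
      obtain ⟨r, s, rfl⟩ := hx
      obtain ⟨r', s', rfl⟩ := hy
      exact ⟨r * r' + s * s' * d, r * s' + s * r', by
        push_cast; linear_combination (s * s' : ℝ) * hd⟩
  · rintro ⟨r, s, rfl⟩
    exact add_mem (SubfieldClass.ratCast_mem _ r)
      (mul_mem (SubfieldClass.ratCast_mem _ s) (sqrt_mem_QF d))

theorem K2_comm (a b : ℕ) : K2 a b = K2 b a := by
  rw [K2, K2, Set.pair_comm]

theorem sqrt_left_mem_K2 (a b : ℕ) : √(a : ℝ) ∈ K2 a b :=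
  IntermediateField.subset_adjoin _ _ (by simp)

theorem sqrt_right_mem_K2 (a b : ℕ) : √(b : ℝ) ∈ K2 a b :=
  IntermediateField.subset_adjoin _ _ (by simp)

theorem exists_coords_of_mem_K2 {a b : ℕ} {x : ℝ} (hx : x ∈ K2 a b) :
    ∃ r s t w : ℚ, x = r + s * √(a : ℝ) + t * √(b : ℝ) + w * (√(a : ℝ) * √(b : ℝ)) := by
  have ha : √(a : ℝ) * √(a : ℝ) = a := Real.mul_self_sqrt (Nat.cast_nonneg a)
  have hb : √(b : ℝ) * √(b : ℝ) = b := Real.mul_self_sqrt (Nat.cast_nonneg b)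
  rw [K2, ← IntermediateField.mem_toSubalgebra,
    IntermediateField.adjoin_toSubalgebra_of_isAlgebraic
      (by rintro _ (rfl | rfl) <;> exact (isIntegral_sqrt_natCast ℚ _).isAlgebraic)] at hx
  induction hx using Algebra.adjoin_induction with
  | mem x h =>
    rcases h with rfl | rfl
    · exact ⟨0, 1, 0, 0, by simp⟩
    · exact ⟨0, 0, 1, 0, by simp⟩
  | algebraMap r => exact ⟨r, 0, 0, 0, by simp⟩
  | add x y _ _ hx hy =>
    obtain ⟨r, s, t, w, rfl⟩ := hx
    obtain ⟨r', s', t', w', rfl⟩ := hy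
    exact ⟨r + r', s + s', t + t', w + w', by push_cast; ring⟩
  | mul x y _ _ hx hy =>
    obtain ⟨r, s, t, w, rfl⟩ := hx
    obtain ⟨r', s', t', w', rfl⟩ := hy
    refine ⟨r * r' + s * s' * a + t * t' * b + w * w' * a * b,
      r * s' + s * r' + (t * w' + w * t') * b, r * t' + t * r' + (s * w' + w * s') * a,
      r * w' + w * r' + s * t' + t * s', ?_⟩
    push_cast
    generalize √(a : ℝ) = A at *
    generalize √(b : ℝ) = B at *
    linear_combination (s * s' + (s * w' + w * s') * B + w * w' * B * B : ℝ) * ha +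
      (t * t' + (t * w' + w * t') * A + w * w' * a : ℝ) * hb

theorem QF_le_K2_left (a b : ℕ) : QF a ≤ K2 a b :=
  IntermediateField.adjoin.mono _ _ _ (by simp)

theorem QF_le_K2_right (a b : ℕ) : QF b ≤ K2 a b :=
  IntermediateField.adjoin.mono _ _ _ (by simp)

theorem QF_mul_le_K2 (a b : ℕ) : QF (a * b) ≤ K2 a b := by
  rw [QF, IntermediateField.adjoin_simple_le_iff, Nat.cast_mul, Real.sqrt_mul (Nat.cast_nonneg a)]
  exact mul_mem (sqrt_left_mem_K2 a b) (sqrt_right_mem_K2 a b)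

theorem natCast_ne_ratCast_sq {n : ℕ} (hn : ¬ IsSquare n) (r : ℚ) : (n : ℝ) ≠ (r : ℝ) ^ 2 := by
  intro h
  have h' : (n : ℚ) = r ^ 2 := by exact_mod_cast h
  exact hn (Rat.isSquare_natCast_iff.1 ⟨r, by rw [h', sq]⟩)

theorem sqrt_notMem_QF {a b : ℕ} (ha : ¬ IsSquare a) (hb : ¬ IsSquare b)
    (hab : ¬ IsSquare (a * b)) : √(a : ℝ) ∉ QF b := by
  intro h
  obtain ⟨r, s, h⟩ := mem_QF_iff.1 h
  have ha2 : √(a : ℝ) ^ 2 = a := Real.sq_sqrt (Nat.cast_nonneg a)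
  have hb2 : √(b : ℝ) ^ 2 = b := Real.sq_sqrt (Nat.cast_nonneg b)
  by_cases hr : r = 0
  · subst hr
    apply natCast_ne_ratCast_sq hab (s * b)
    rw [h] at ha2
    push_cast at ha2 ⊢
    rw [← ha2, zero_add, mul_pow, hb2]
    ring
  by_cases hs : s = 0
  · subst hs
    apply natCast_ne_ratCast_sq ha r
    rw [← ha2, h]
    simp
  · apply irrational_sqrt_natCast_iff.2 hb
    refine ⟨(a - r ^ 2 - s ^ 2 * b) / (2 * r * s), ?_⟩
    rw [h] at ha2
    push_cast
    rw [div_eq_iff (by simp [hr, hs])]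
    linear_combination -ha2 + (s : ℝ) ^ 2 * hb2

/-- The embedding of `ℚ(√a, √b)` in `ℝ` which sends `√a` to `-√a` and `√b` to `√b`. -/
theorem exists_conj_left {a b : ℕ} (ha : ¬ IsSquare a) (hb : ¬ IsSquare b)
    (hab : ¬ IsSquare (a * b)) :
    ∃ σ : K2 a b →+* ℝ, ∀ (x : K2 a b) (r s t w : ℚ),
      (x : ℝ) = r + s * √(a : ℝ) + t * √(b : ℝ) + w * (√(a : ℝ) * √(b : ℝ)) →
      σ x = r - s * √(a : ℝ) + t * √(b : ℝ) - w * (√(a : ℝ) * √(b : ℝ)) := by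
  have hint : IsIntegral (QF b) √(a : ℝ) := isIntegral_sqrt_natCast _ a
  have hmin : Polynomial.X ^ 2 - Polynomial.C (a : QF b) = minpoly (QF b) √(a : ℝ) := by
    apply minpoly.eq_of_irreducible_of_monic
    · rw [X_pow_sub_C_irreducible_iff_of_prime Nat.prime_two]
      intro y hy
      have hy' : (y : ℝ) ^ 2 = √(a : ℝ) ^ 2 := by
        rw [Real.sq_sqrt (Nat.cast_nonneg a)]
        exact_mod_cast congrArg (Subtype.val) hy
      rcases sq_eq_sq_iff_eq_or_eq_neg.1 hy' with h | h
      · exact sqrt_notMem_QF ha hb hab (h ▸ y.2)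
      · exact sqrt_notMem_QF ha hb hab (neg_mem_iff.1 (h ▸ y.2))
    · simp
    · exact Polynomial.monic_X_pow_sub_C _ two_ne_zero
  let L := IntermediateField.adjoin (QF b) {√(a : ℝ)}
  have hKL : K2 a b = L.restrictScalars ℚ := by
    rw [K2, Set.pair_comm, ← Set.singleton_union]
    exact (IntermediateField.adjoin_adjoin_left ℚ {√(b : ℝ)} {√(a : ℝ)}).symm
  let pb := IntermediateField.adjoin.powerBasis hint
  have hgen : pb.gen = IntermediateField.AdjoinSimple.gen (QF b) √(a : ℝ) :=
    IntermediateField.adjoin.powerBasis_gen hint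
  have hroot : Polynomial.aeval (-√(a : ℝ)) (minpoly (QF b) pb.gen) = 0 := by
    rw [hgen, IntermediateField.minpoly_gen, ← hmin]
    simp
  let φ : L →ₐ[QF b] ℝ := pb.lift (-√(a : ℝ)) hroot
  have hφ : φ pb.gen = -√(a : ℝ) := pb.lift_gen _ hroot
  have hmem : ∀ x : K2 a b, (x : ℝ) ∈ L := fun x =>
    (IntermediateField.mem_restrictScalars ℚ).1 (hKL ▸ x.2)
  let ι : K2 a b →+* L :=
    { toFun := fun x => ⟨x, hmem x⟩
      map_one' := rfl
      map_mul' := fun _ _ => rfl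
      map_zero' := rfl
      map_add' := fun _ _ => rfl }
  refine ⟨φ.toRingHom.comp ι, fun x r s t w hx => ?_⟩
  have hιx : ι x = (r : L) + s * pb.gen + t * algebraMap (QF b) L ⟨√(b : ℝ), sqrt_mem_QF b⟩ +
      w * (pb.gen * algebraMap (QF b) L ⟨√(b : ℝ), sqrt_mem_QF b⟩) := by
    apply Subtype.ext
    rw [hgen]
    exact hx
  change φ (ι x) = _
  rw [hιx]
  simp only [map_add, map_mul, map_ratCast, hφ, AlgHom.commutes]
  change (r : ℝ) + s * -√(a : ℝ) + t * √(b : ℝ) + w * (-√(a : ℝ) * √(b : ℝ)) = _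
  ring

/-- The embedding of `ℚ(√a, √b)` in `ℝ` which sends `√a` to `√a` and `√b` to `-√b`. -/
theorem exists_conj_right {a b : ℕ} (ha : ¬ IsSquare a) (hb : ¬ IsSquare b)
    (hab : ¬ IsSquare (a * b)) :
    ∃ τ : K2 a b →+* ℝ, ∀ (x : K2 a b) (r s t w : ℚ),
      (x : ℝ) = r + s * √(a : ℝ) + t * √(b : ℝ) + w * (√(a : ℝ) * √(b : ℝ)) →
      τ x = r + s * √(a : ℝ) - t * √(b : ℝ) - w * (√(a : ℝ) * √(b : ℝ)) := by
  obtain ⟨τ, hτ⟩ := exists_conj_left hb ha (by rwa [mul_comm])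
  rw [K2_comm]
  refine ⟨τ, fun x r s t w hx => ?_⟩
  rw [hτ x r t s w (by rw [hx]; ring)]
  ring

/-- `x` is the real value of a unit of the ring of integers of `F`. -/
def IsUnitVal (F : IntermediateField ℚ ℝ) (x : ℝ) : Prop :=
  ∃ u : (integralClosure ℤ F)ˣ, uval u = x

section uval

variable {F : IntermediateField ℚ ℝ}

theorem uval_mul (u v : (integralClosure ℤ F)ˣ) : uval (u * v) = uval u * uval v := rfl

theorem uval_one : uval (1 : (integralClosure ℤ F)ˣ) = 1 := rfl

theorem uval_neg (u : (integralClosure ℤ F)ˣ) : uval (-u) = -uval u := rfl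

theorem uval_mul_inv (u : (integralClosure ℤ F)ˣ) : uval u * uval u⁻¹ = 1 := by
  rw [← uval_mul, mul_inv_cancel, uval_one]

theorem uval_inv (u : (integralClosure ℤ F)ˣ) : uval u⁻¹ = (uval u)⁻¹ :=
  eq_inv_of_mul_eq_one_right (uval_mul_inv u)

theorem uval_ne_zero (u : (integralClosure ℤ F)ˣ) : uval u ≠ 0 :=
  left_ne_zero_of_mul_eq_one (uval_mul_inv u)

theorem uval_zpow (u : (integralClosure ℤ F)ˣ) (n : ℤ) : uval (u ^ n) = uval u ^ n := by
  have hpow : ∀ k : ℕ, uval (u ^ k) = uval u ^ k := fun _ => rfl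
  cases n with
  | ofNat k => exact hpow k
  | negSucc k => rw [zpow_negSucc, zpow_negSucc, uval_inv, hpow]

theorem uval_injective : Function.Injective (uval (K := F)) := fun _ _ h =>
  Units.ext (Subtype.ext (Subtype.ext h))

theorem uval_mem (u : (integralClosure ℤ F)ˣ) : uval u ∈ F :=
  ((u : integralClosure ℤ F) : F).2

theorem isIntegral_map_unit (σ : F →+* ℝ) (u : (integralClosure ℤ F)ˣ) :
    IsIntegral ℤ (σ (u : integralClosure ℤ F)) :=
  (u : integralClosure ℤ F).2.map σ.toIntAlgHom

theorem map_unit_mul_map_inv (σ : F →+* ℝ) (u : (integralClosure ℤ F)ˣ) :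
    σ (u : integralClosure ℤ F) * σ ((u⁻¹ : (integralClosure ℤ F)ˣ) : integralClosure ℤ F) = 1 := by
  rw [← map_mul, ← MulMemClass.coe_mul, Units.mul_inv, OneMemClass.coe_one, map_one]

namespace IsUnitVal

theorem mk {x y : ℝ} (hx : x ∈ F) (hxi : IsIntegral ℤ x) (hyi : IsIntegral ℤ y)
    (hxy : x * y = 1) : IsUnitVal F x := by
  have hy : y ∈ F := by
    rw [eq_inv_of_mul_eq_one_right hxy]
    exact inv_mem hx
  have hi : ∀ z : F, IsIntegral ℤ (z : ℝ) → IsIntegral ℤ z := fun z hz =>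
    (isIntegral_algebraMap_iff (algebraMap F ℝ).injective).1 hz
  have h1 : (⟨⟨x, hx⟩, hi _ hxi⟩ : integralClosure ℤ F) * ⟨⟨y, hy⟩, hi _ hyi⟩ = 1 :=
    Subtype.ext (Subtype.ext hxy)
  exact ⟨⟨_, _, h1, (mul_comm _ _).trans h1⟩, rfl⟩

theorem mul {x y : ℝ} (hx : IsUnitVal F x) (hy : IsUnitVal F y) : IsUnitVal F (x * y) := by
  obtain ⟨u, rfl⟩ := hx
  obtain ⟨v, rfl⟩ := hy
  exact ⟨u * v, rfl⟩

theorem zpow {x : ℝ} (hx : IsUnitVal F x) (n : ℤ) : IsUnitVal F (x ^ n) := by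
  obtain ⟨u, rfl⟩ := hx
  exact ⟨u ^ n, uval_zpow u n⟩

theorem mono {F' : IntermediateField ℚ ℝ} (h : F ≤ F') {x : ℝ} (hx : IsUnitVal F x) :
    IsUnitVal F' x := by
  obtain ⟨u, rfl⟩ := hx
  exact mk (h (uval_mem u)) (isIntegral_map_unit (algebraMap F ℝ) u)
    (isIntegral_map_unit (algebraMap F ℝ) u⁻¹) (uval_mul_inv u)

end IsUnitVal

end uval

namespace IsFundUnit

variable {d : ℕ} {t : ℝ}

theorem isUnitVal (h : IsFundUnit d t) : IsUnitVal (QF d) t :=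
  let ⟨ε, hε, _⟩ := h
  ⟨ε, hε⟩

theorem pos (h : IsFundUnit d t) : 0 < t :=
  let ⟨_, _, h1, _⟩ := h
  zero_lt_one.trans h1

theorem exists_abs_eq_zpow (h : IsFundUnit d t) {x : ℝ} (hx : IsUnitVal (QF d) x) :
    ∃ n : ℤ, |x| = t ^ n := by
  have ht := h.pos
  obtain ⟨ε, rfl, -, hgen⟩ := h
  obtain ⟨u, rfl⟩ := hx
  obtain ⟨n, rfl | rfl⟩ := hgen u
  · exact ⟨n, by rw [uval_zpow, abs_of_pos (zpow_pos ht n)]⟩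
  · exact ⟨n, by rw [uval_neg, uval_zpow, abs_neg, abs_of_pos (zpow_pos ht n)]⟩

end IsFundUnit

theorem not_isSquare_two_mul {n : ℕ} (hn : n % 2 = 1) : ¬ IsSquare (2 * n) := by
  rintro ⟨c, hc⟩
  have : 2 ∣ c := (Nat.prime_two.dvd_mul.1 (hc ▸ dvd_mul_right 2 n)).elim id id
  obtain ⟨c, rfl⟩ := this
  have : n = 2 * (c * c) := by nlinarith
  omega

theorem ratCast_mul_sqrt_sq_ne_two {n : ℕ} (hn : n % 2 = 1) (r : ℚ) :
    ((r : ℝ) * √(n : ℝ)) ^ 2 ≠ 2 := by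
  intro h
  rw [mul_pow, Real.sq_sqrt (Nat.cast_nonneg n)] at h
  apply natCast_ne_ratCast_sq (not_isSquare_two_mul hn) (r * n)
  push_cast
  rw [← h]
  ring

theorem isUnitVal_add_mul_sqrt {d : ℕ} {a b c e : ℤ}
    (h : ((a : ℝ) + b * √(d : ℝ)) * (c + e * √(d : ℝ)) = 1) :
    IsUnitVal (QF d) (a + b * √(d : ℝ)) := by
  have hi : ∀ m n : ℤ, IsIntegral ℤ ((m : ℝ) + n * √(d : ℝ)) := fun m n =>
    (isIntegral_intCast m).add ((isIntegral_intCast n).mul (isIntegral_sqrt_natCast ℤ d))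
  exact IsUnitVal.mk (mem_QF_iff.2 ⟨a, b, by push_cast; rfl⟩) (hi a b) (hi c e) h

section Biquadratic

variable {p q : ℕ}

theorem sq_ne_two_of_mem_K2 (hp : p % 2 = 1) (hq : q % 2 = 1) (hps : ¬ IsSquare p)
    (hqs : ¬ IsSquare q) (hpqs : ¬ IsSquare (p * q)) {x : ℝ} (hx : x ∈ K2 p q) : x ^ 2 ≠ 2 := by
  intro h
  obtain ⟨r, s, t, w, hc⟩ := exists_coords_of_mem_K2 hx
  obtain ⟨σ, hσ⟩ := exists_conj_left hps hqs hpqs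
  obtain ⟨τ, hτ⟩ := exists_conj_right hps hqs hpqs
  have hx2 : (⟨x, hx⟩ : K2 p q) ^ 2 = 2 := Subtype.ext h
  have hconj : ∀ ρ : K2 p q →+* ℝ, ρ ⟨x, hx⟩ = x ∨ ρ ⟨x, hx⟩ = -x := fun ρ => by
    rw [← sq_eq_sq_iff_eq_or_eq_neg, ← map_pow, hx2, map_ofNat, h]
  have hpq : √((p * q : ℕ) : ℝ) = √(p : ℝ) * √(q : ℝ) := by
    rw [Nat.cast_mul, Real.sqrt_mul (Nat.cast_nonneg p)]
  have h1 := hconj σ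
  have h2 := hconj τ
  rw [hσ _ r s t w hc] at h1
  rcases h1 with h1 | h1
  · rw [hτ _ r 0 t 0 (by push_cast; linarith)] at h2
    push_cast at h2
    rcases h2 with h2 | h2
    · refine ratCast_mul_sqrt_sq_ne_two (n := 1) rfl r ?_
      rw [← h, Nat.cast_one, Real.sqrt_one]
      congr 1
      linarith
    · refine ratCast_mul_sqrt_sq_ne_two hq t ?_
      rw [← h]
      congr 1
      linarith
  · rw [hτ _ 0 s 0 w (by push_cast; linarith)] at h2
    push_cast at h2
    rcases h2 with h2 | h2
    · refine ratCast_mul_sqrt_sq_ne_two hp s ?_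
      rw [← h]
      congr 1
      linarith
    · refine ratCast_mul_sqrt_sq_ne_two (n := p * q) (by simp [Nat.mul_mod, hp, hq]) w ?_
      rw [← h, hpq]
      congr 1
      linarith

/-- The square of a unit of `ℚ(√p, √q)` is a product of powers of the fundamental units
of the three quadratic subfields. -/
theorem exists_sq_eq_zpow_mul_zpow_mul_zpow (hps : ¬ IsSquare p) (hqs : ¬ IsSquare q)
    (hpqs : ¬ IsSquare (p * q)) {ep eq' epq : ℝ} (hep : IsFundUnit p ep) (heq : IsFundUnit q eq')
    (hepq : IsFundUnit (p * q) epq) {x : ℝ} (hx : IsUnitVal (K2 p q) x) :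
    ∃ a b c : ℤ, x ^ 2 = ep ^ a * eq' ^ b * epq ^ c := by
  obtain ⟨u, rfl⟩ := hx
  have hp2 : √(p : ℝ) ^ 2 = p := Real.sq_sqrt (Nat.cast_nonneg p)
  have hq2 : √(q : ℝ) ^ 2 = q := Real.sq_sqrt (Nat.cast_nonneg q)
  have hpq : √((p * q : ℕ) : ℝ) = √(p : ℝ) * √(q : ℝ) := by
    rw [Nat.cast_mul, Real.sqrt_mul (Nat.cast_nonneg p)]
  obtain ⟨r, s, t, w, hc⟩ := exists_coords_of_mem_K2 (uval_mem u)
  obtain ⟨σ, hσ⟩ := exists_conj_left hps hqs hpqs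
  obtain ⟨τ, hτ⟩ := exists_conj_right hps hqs hpqs
  have hσu := hσ _ r s t w hc
  have hτu := hτ _ r s t w hc
  have hmk : ∀ (ρ ρ' : K2 p q →+* ℝ) (d : ℕ),
      ρ (u : integralClosure ℤ (K2 p q)) * ρ' (u : integralClosure ℤ (K2 p q)) ∈ QF d →
      IsUnitVal (QF d) (ρ (u : integralClosure ℤ (K2 p q)) *
        ρ' (u : integralClosure ℤ (K2 p q))) := fun ρ ρ' d h =>
    IsUnitVal.mk h ((isIntegral_map_unit ρ u).mul (isIntegral_map_unit ρ' u))
      ((isIntegral_map_unit ρ u⁻¹).mul (isIntegral_map_unit ρ' u⁻¹)) (by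
        rw [mul_mul_mul_comm, map_unit_mul_map_inv, map_unit_mul_map_inv, one_mul])
  have hι : algebraMap (K2 p q) ℝ (u : integralClosure ℤ (K2 p q)) = uval u := rfl
  obtain ⟨b, hb⟩ := heq.exists_abs_eq_zpow (hmk (algebraMap (K2 p q) ℝ) σ q
    (mem_QF_iff.2 ⟨r ^ 2 + q * t ^ 2 - p * s ^ 2 - p * q * w ^ 2, 2 * r * t - 2 * p * s * w, by
      rw [hι, hc, hσu]
      push_cast
      linear_combination (t ^ 2 - p * w ^ 2 : ℝ) * hq2 - ((s + w * √(q : ℝ)) ^ 2 : ℝ) * hp2⟩))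
  obtain ⟨a, ha⟩ := hep.exists_abs_eq_zpow (hmk (algebraMap (K2 p q) ℝ) τ p
    (mem_QF_iff.2 ⟨r ^ 2 + p * s ^ 2 - q * t ^ 2 - p * q * w ^ 2, 2 * r * s - 2 * q * t * w, by
      rw [hι, hc, hτu]
      push_cast
      linear_combination (s ^ 2 - q * w ^ 2 : ℝ) * hp2 - ((t + w * √(p : ℝ)) ^ 2 : ℝ) * hq2⟩))
  obtain ⟨c, hc'⟩ := hepq.exists_abs_eq_zpow (hmk σ τ (p * q)
    (mem_QF_iff.2 ⟨r ^ 2 + p * q * w ^ 2 - p * s ^ 2 - q * t ^ 2, 2 * s * t - 2 * r * w, by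
      rw [hσu, hτu, hpq]
      push_cast
      linear_combination (w ^ 2 * √(q : ℝ) ^ 2 - s ^ 2 : ℝ) * hp2 + (w ^ 2 * p - t ^ 2 : ℝ) * hq2⟩))
  refine ⟨a, b, -c, ?_⟩
  have h1 := left_ne_zero_of_mul_eq_one (map_unit_mul_map_inv σ u)
  have h2 := left_ne_zero_of_mul_eq_one (map_unit_mul_map_inv τ u)
  rw [zpow_neg, ← ha, ← hb, ← hc', ← div_eq_mul_inv, eq_div_iff (abs_ne_zero.2 (mul_ne_zero h1 h2)),
    hι, ← sq_abs (uval u), abs_mul, abs_mul, abs_mul]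
  ring

/-- If `p * a ^ 2 - q * b ^ 2 = ± 1` then the fundamental unit of `ℚ(√(p * q))` is a square in
`ℚ(√p, √q)`. -/
theorem exists_sq_eq_fundUnit_mul (hps : ¬ IsSquare p) (hqs : ¬ IsSquare q)
    (hpqs : ¬ IsSquare (p * q)) {epq : ℝ} (hepq : IsFundUnit (p * q) epq) {a b : ℕ}
    (hab : p * a ^ 2 = q * b ^ 2 + 1 ∨ q * b ^ 2 = p * a ^ 2 + 1) :
    ∃ y, IsUnitVal (K2 p q) y ∧ y ^ 2 = epq := by
  have hp2 : √(p : ℝ) ^ 2 = p := Real.sq_sqrt (Nat.cast_nonneg p)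
  have hq2 : √(q : ℝ) ^ 2 = q := Real.sq_sqrt (Nat.cast_nonneg q)
  have hpq : √((p * q : ℕ) : ℝ) = √(p : ℝ) * √(q : ℝ) := by
    rw [Nat.cast_mul, Real.sqrt_mul (Nat.cast_nonneg p)]
  have hb0 : b ≠ 0 := by
    rintro rfl
    rcases hab with h | h
    · have := Nat.eq_one_of_mul_eq_one_right (by simpa using h : p * a ^ 2 = 1)
      exact hps (this ▸ IsSquare.one)
    · simp at h
  obtain ⟨e, he, hn⟩ : ∃ e : ℤ, (e : ℝ) ^ 2 = 1 ∧ (p * a ^ 2 - q * b ^ 2 : ℝ) = e := by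
    rcases hab with h | h
    · have h' : (p * a ^ 2 : ℝ) = q * b ^ 2 + 1 := by exact_mod_cast h
      exact ⟨1, by simp, by rw [h']; simp⟩
    · have h' : (q * b ^ 2 : ℝ) = p * a ^ 2 + 1 := by exact_mod_cast h
      exact ⟨-1, by simp, by rw [h']; simp⟩
  have hi : ∀ m n : ℤ, IsIntegral ℤ ((m : ℝ) * √(p : ℝ) + n * √(q : ℝ)) := fun m n =>
    ((isIntegral_intCast m).mul (isIntegral_sqrt_natCast ℤ p)).add
      ((isIntegral_intCast n).mul (isIntegral_sqrt_natCast ℤ q))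
  set α : ℝ := a * √(p : ℝ) + b * √(q : ℝ) with hα
  have hαK : α ∈ K2 p q :=
    add_mem (mul_mem (natCast_mem _ a) (sqrt_left_mem_K2 p q))
      (mul_mem (natCast_mem _ b) (sqrt_right_mem_K2 p q))
  have hαu : IsUnitVal (K2 p q) α := by
    refine IsUnitVal.mk (y := ((e * a : ℤ) : ℝ) * √(p : ℝ) + ((-e * b : ℤ) : ℝ) * √(q : ℝ))
      hαK (by exact_mod_cast hi a b) (hi _ _) ?_
    push_cast
    linear_combination (e * a ^ 2 : ℝ) * hp2 - (e * b ^ 2 : ℝ) * hq2 + (e : ℝ) * hn + he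
  have hα2 : IsUnitVal (QF (p * q)) (α ^ 2) := by
    have h := isUnitVal_add_mul_sqrt (d := p * q) (a := p * a ^ 2 + q * b ^ 2) (b := 2 * a * b)
      (c := p * a ^ 2 + q * b ^ 2) (e := -(2 * a * b)) (by
        rw [hpq]
        push_cast
        linear_combination (-4 * a ^ 2 * b ^ 2 * √(q : ℝ) ^ 2 : ℝ) * hp2
          - (4 * a ^ 2 * b ^ 2 * p : ℝ) * hq2 + (p * a ^ 2 - q * b ^ 2 + e : ℝ) * hn + he)
    convert h using 1
    rw [hpq]
    push_cast
    linear_combination (a ^ 2 : ℝ) * hp2 + (b ^ 2 : ℝ) * hq2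
  have hαQ : α ∉ QF (p * q) := by
    intro h
    obtain ⟨r, t, h⟩ := mem_QF_iff.1 h
    rw [hpq] at h
    obtain ⟨σ, hσ⟩ := exists_conj_left hps hqs hpqs
    have h1 := hσ ⟨α, hαK⟩ 0 a b 0 (by push_cast; rw [hα]; ring)
    have h2 := hσ ⟨α, hαK⟩ r 0 0 t (by push_cast; rw [h]; ring)
    rw [h1] at h2
    push_cast at h2
    refine irrational_sqrt_natCast_iff.2 hqs ⟨r / b, ?_⟩
    push_cast
    rw [div_eq_iff (by exact_mod_cast hb0)]
    linarith
  obtain ⟨n, hn⟩ := hepq.exists_abs_eq_zpow hα2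
  rw [abs_of_nonneg (sq_nonneg α)] at hn
  have hpos := hepq.pos
  obtain ⟨k, rfl | rfl⟩ := Int.even_or_odd' n
  · exfalso
    have hk : epq ^ k ∈ QF (p * q) := by
      obtain ⟨u, hu⟩ := hepq.isUnitVal.zpow k
      exact hu ▸ uval_mem u
    rw [mul_comm, zpow_mul, zpow_ofNat, sq_eq_sq_iff_eq_or_eq_neg] at hn
    rcases hn with hn | hn
    · exact hαQ (hn ▸ hk)
    · exact hαQ (hn ▸ neg_mem hk)
  · refine ⟨α * epq ^ (-k), hαu.mul ((hepq.isUnitVal.mono (QF_mul_le_K2 p q)).zpow _), ?_⟩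
    rw [mul_pow, hn, ← zpow_ofNat, ← zpow_mul, ← zpow_add₀ hpos.ne']
    convert zpow_one epq using 2
    ring

/-- The norm of the fundamental unit of `ℚ(√p)` is negative as soon as `a ^ 2 - p * b ^ 2 = -1` is
solvable. -/
theorem map_fundUnit_neg {ep : ℝ} (hep : IsFundUnit p ep) {a b : ℕ} (hab : a ^ 2 + 1 = p * b ^ 2)
    {σ : K2 p q →+* ℝ}
    (hσ : ∀ (x : K2 p q) (r s t w : ℚ),
      (x : ℝ) = r + s * √(p : ℝ) + t * √(q : ℝ) + w * (√(p : ℝ) * √(q : ℝ)) →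
      σ x = r - s * √(p : ℝ) + t * √(q : ℝ) - w * (√(p : ℝ) * √(q : ℝ)))
    {x : K2 p q} (hx : (x : ℝ) = ep) : σ x < 0 := by
  have hp2 : √(p : ℝ) ^ 2 = p := Real.sq_sqrt (Nat.cast_nonneg p)
  have hab' : (a ^ 2 + 1 : ℝ) = p * b ^ 2 := by exact_mod_cast hab
  have hu := isUnitVal_add_mul_sqrt (d := p) (a := a) (b := b) (c := -a) (e := b) (by
    push_cast
    linear_combination (b ^ 2 : ℝ) * hp2 - hab')
  push_cast at hu
  have hxp : 0 < (x : ℝ) := hx ▸ hep.pos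
  obtain ⟨n, hn⟩ := hep.exists_abs_eq_zpow hu
  obtain ⟨y, hy⟩ : ∃ y : K2 p q, (y : ℝ) = a + b * √(p : ℝ) :=
    ⟨⟨a + b * √(p : ℝ), add_mem (natCast_mem _ a)
      (mul_mem (natCast_mem _ b) (sqrt_left_mem_K2 p q))⟩, rfl⟩
  have hσy := hσ y a b 0 0 (by push_cast; rw [hy]; ring)
  push_cast at hσy
  have hcoe : ((x ^ n : K2 p q) : ℝ) = (x : ℝ) ^ n := map_zpow₀ (algebraMap (K2 p q) ℝ) x n
  have hyx : y = x ^ n ∨ y = -x ^ n := by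
    rw [← hy, ← hx] at hn
    rcases abs_choice (y : ℝ) with h | h <;> rw [h] at hn
    · left
      exact Subtype.ext (hn.trans hcoe.symm)
    · right
      apply Subtype.ext
      push_cast
      rw [hcoe, ← hn, neg_neg]
  have hneg : (y : ℝ) * σ y = -1 := by
    rw [hy, hσy]
    linear_combination -(b ^ 2 : ℝ) * hp2 + hab'
  by_contra hx0
  have hpos : 0 ≤ ((x : ℝ) ^ n) * σ x ^ n :=
    mul_nonneg (zpow_nonneg hxp.le n) (zpow_nonneg (not_lt.1 hx0) n)
  rcases hyx with rfl | rfl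
  · rw [map_zpow₀, hcoe] at hneg
    linarith
  · rw [map_neg, map_zpow₀, NegMemClass.coe_neg, hcoe] at hneg
    linarith

/-- If `a ^ 2 - q * b ^ 2 = -2` then twice some power of the fundamental unit of `ℚ(√q)` is a
square in `ℚ(√q)`. -/
theorem exists_sq_eq_two_mul_zpow {eq' : ℝ} (heq : IsFundUnit q eq') {a b : ℕ}
    (hab : a ^ 2 + 2 = q * b ^ 2) : ∃ β ∈ QF q, ∃ n : ℤ, β ^ 2 = 2 * eq' ^ n := by
  have hq2 : √(q : ℝ) ^ 2 = q := Real.sq_sqrt (Nat.cast_nonneg q)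
  have hab' : (a ^ 2 + 2 : ℝ) = q * b ^ 2 := by exact_mod_cast hab
  have hu := isUnitVal_add_mul_sqrt (d := q) (a := a ^ 2 + 1) (b := a * b) (c := a ^ 2 + 1)
    (e := -(a * b)) (by
      push_cast
      linear_combination -(a ^ 2 * b ^ 2 : ℝ) * hq2 + (a ^ 2 : ℝ) * hab')
  push_cast at hu
  obtain ⟨n, hn⟩ := heq.exists_abs_eq_zpow hu
  rw [abs_of_nonneg (by positivity)] at hn
  refine ⟨a + b * √(q : ℝ), mem_QF_iff.2 ⟨a, b, by push_cast; rfl⟩, n, ?_⟩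
  rw [← hn]
  linear_combination (b ^ 2 : ℝ) * hq2 - hab'

theorem even_even_of_sq_eq_zpow_mul_zpow (hp : p % 2 = 1) (hq : q % 2 = 1) (hps : ¬ IsSquare p)
    (hqs : ¬ IsSquare q) (hpqs : ¬ IsSquare (p * q)) {ep eq' : ℝ} (hep : IsFundUnit p ep)
    (heq : IsFundUnit q eq') {a b c d : ℕ} (hab : a ^ 2 + 1 = p * b ^ 2)
    (hcd : c ^ 2 + 2 = q * d ^ 2) {y : ℝ} (hy : y ∈ K2 p q) {m n : ℤ}
    (h : y ^ 2 = ep ^ m * eq' ^ n) : Even m ∧ Even n := by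
  have hepK : ep ∈ K2 p q := by
    obtain ⟨u, hu⟩ := hep.isUnitVal
    exact QF_le_K2_left p q (hu ▸ uval_mem u)
  have heqQ : eq' ∈ QF q := by
    obtain ⟨u, hu⟩ := heq.isUnitVal
    exact hu ▸ uval_mem u
  have heqK : eq' ∈ K2 p q := QF_le_K2_right p q heqQ
  have hp0 := hep.pos
  have hq0 := heq.pos
  have hm : Even m := by
    obtain ⟨σ, hσ⟩ := exists_conj_left hps hqs hpqs
    have hneg : σ ⟨ep, hepK⟩ < 0 := map_fundUnit_neg hep hab hσ rfl
    have hfix : σ ⟨eq', heqK⟩ = eq' := by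
      obtain ⟨r, t, hrt⟩ := mem_QF_iff.1 heqQ
      rw [hσ _ r 0 t 0 (by push_cast; rw [← sub_eq_zero]; linear_combination hrt), hrt]
      push_cast
      ring
    have hK : (⟨y, hy⟩ : K2 p q) ^ 2 = (⟨ep, hepK⟩ : K2 p q) ^ m * (⟨eq', heqK⟩ : K2 p q) ^ n := by
      apply (algebraMap (K2 p q) ℝ).injective
      rw [map_pow, map_mul, map_zpow₀, map_zpow₀]
      exact h
    have h2 := congrArg σ hK
    rw [map_pow, map_mul, map_zpow₀, map_zpow₀, hfix] at h2
    by_contra hodd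
    have h3 : σ ⟨ep, hepK⟩ ^ m < 0 := (Int.not_even_iff_odd.1 hodd).zpow_neg hneg
    have h4 := mul_neg_of_neg_of_pos h3 (zpow_pos hq0 n)
    linarith [sq_nonneg (σ ⟨y, hy⟩)]
  refine ⟨hm, ?_⟩
  by_contra hodd
  obtain ⟨k, rfl⟩ := hm
  obtain ⟨l, rfl⟩ := Int.not_even_iff_odd.1 hodd
  obtain ⟨β, hβ, j, hj⟩ := exists_sq_eq_two_mul_zpow heq hcd
  have hw : (y * ep ^ (-k) * eq' ^ (-l)) ^ 2 = eq' := by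
    rw [mul_pow, mul_pow, h, zpow_add₀ hp0.ne', two_mul, zpow_add₀ hq0.ne', zpow_add₀ hq0.ne',
      zpow_one, zpow_neg, zpow_neg]
    have := zpow_ne_zero k hp0.ne'
    have := zpow_ne_zero l hq0.ne'
    field_simp
  have hwK : y * ep ^ (-k) * eq' ^ (-l) ∈ K2 p q :=
    mul_mem (mul_mem hy (zpow_mem hepK _)) (zpow_mem heqK _)
  generalize y * ep ^ (-k) * eq' ^ (-l) = w at hw hwK
  apply sq_ne_two_of_mem_K2 hp hq hps hqs hpqs
    (mul_mem (QF_le_K2_right p q hβ) (zpow_mem hwK (-j)))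
  have hwj : (w ^ (-j)) ^ 2 = (eq' ^ j)⁻¹ := by
    rw [← zpow_ofNat, zpow_comm, zpow_ofNat, hw, zpow_neg]
  rw [mul_pow, hj, hwj, mul_assoc, mul_inv_cancel₀ (zpow_ne_zero j hq0.ne'), mul_one]

end Biquadratic

theorem fsu_Qsqrtp_sqrtq_legendre_one
    (p q : ℕ) [Fact (Nat.Prime p)] [Fact (Nat.Prime q)]
    (hp : p % 8 = 5) (hq : q % 8 = 3) (hleg : legendreSym q (p : ℤ) = 1)
    (ep eq' epq : ℝ)
    (hep : IsFundUnit p ep) (heq : IsFundUnit q eq')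
    (hepq : IsFundUnit (p * q) epq) :
    (∃ Ep : (integralClosure ℤ (K2 p q))ˣ, uval Ep = ep) ∧
    (∃ Eq' : (integralClosure ℤ (K2 p q))ˣ, uval Eq' = eq') ∧
    (∃ U : (integralClosure ℤ (K2 p q))ˣ, uval U ^ 2 = epq) ∧
    ∀ Ep Eq' U : (integralClosure ℤ (K2 p q))ˣ,
      uval Ep = ep → uval Eq' = eq' → uval U ^ 2 = epq →
      Subgroup.closure {(-1 : (integralClosure ℤ (K2 p q))ˣ), Ep, Eq', U} = ⊤ := by
  have hpp : p.Prime := Fact.out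
  have hqp : q.Prime := Fact.out
  have hps := hpp.prime.not_isSquare
  have hqs := hqp.prime.not_isSquare
  have hpqs := not_isSquare_prime_mul_prime hpp hqp (by omega)
  obtain ⟨a, b, hab⟩ := exists_sq_add_one_eq_prime_mul_sq hpp (by omega)
  obtain ⟨c, d, hcd⟩ := exists_sq_add_two_eq_prime_mul_sq hqp hq
  obtain ⟨e, f, hef⟩ := exists_prime_mul_sq_sub_prime_mul_sq hp hq hleg
  obtain ⟨-, ⟨V, rfl⟩, hV⟩ := exists_sq_eq_fundUnit_mul hps hqs hpqs hepq hef
  refine ⟨hep.isUnitVal.mono (QF_le_K2_left p q), heq.isUnitVal.mono (QF_le_K2_right p q),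
    ⟨V, hV⟩, fun Ep Eq' U hEp hEq hU => ?_⟩
  rw [eq_top_iff]
  rintro x -
  obtain ⟨k, l, m, hx⟩ := exists_sq_eq_zpow_mul_zpow_mul_zpow hps hqs hpqs hep heq hepq ⟨x, rfl⟩
  have hy : uval (x * U ^ (-m)) ^ 2 = ep ^ k * eq' ^ l := by
    rw [uval_mul, mul_pow, hx, uval_zpow, ← hU, ← zpow_ofNat (uval U ^ (-m)), ← zpow_mul,
      ← zpow_ofNat (uval U), ← zpow_mul, mul_assoc, ← zpow_add₀ (uval_ne_zero U)]
    ring_nf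
    simp
  obtain ⟨⟨i, rfl⟩, ⟨j, rfl⟩⟩ := even_even_of_sq_eq_zpow_mul_zpow (by omega) (by omega) hps hqs hpqs
    hep heq hab hcd (uval_mem _) hy
  have hz : uval (x * U ^ (-m)) ^ 2 = uval (Ep ^ i * Eq' ^ j) ^ 2 := by
    rw [hy, uval_mul, uval_zpow, uval_zpow, hEp, hEq, zpow_add₀ hep.pos.ne',
      zpow_add₀ heq.pos.ne']
    ring
  have hx' : x = Ep ^ i * Eq' ^ j * U ^ m ∨ x = -1 * (Ep ^ i * Eq' ^ j * U ^ m) := by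
    rcases sq_eq_sq_iff_eq_or_eq_neg.1 hz with h | h
    · left
      rw [← uval_injective h, zpow_neg, inv_mul_cancel_right]
    · right
      rw [← uval_neg] at h
      rw [neg_one_mul, ← neg_mul, ← uval_injective h, zpow_neg, inv_mul_cancel_right]
  set S : Set (integralClosure ℤ (K2 p q))ˣ := {-1, Ep, Eq', U}
  have hmem : Ep ^ i * Eq' ^ j * U ^ m ∈ Subgroup.closure S :=
    mul_mem (mul_mem (zpow_mem (Subgroup.subset_closure (by simp [S])) i)
      (zpow_mem (Subgroup.subset_closure (by simp [S])) j))
      (zpow_mem (Subgroup.subset_closure (by simp [S])) m)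
  rcases hx' with h | h <;> rw [h]
  · exact hmem
  · exact mul_mem (Subgroup.subset_closure (by simp [S])) hmem
end
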